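/- (Bonnesen-type inequality for H² under a containment hypothesis.) Let K be a compact geodesically convex subset of the hyperbolic plane H² (of constant curvature −1) with nonempty interior, and suppose K is contained in some closed hyperbolic disc of radius η = ln(1 + √2) (so that sinh η = 1). Then P_K² − A_K·(4π + A_K) ≥ (sinh R_K − sinh r_K)²·((2π + A_K)² − P_K²)² / (4·(2π + A_K)²). -/

import Mathlib

open MeasureTheory Metric Real UpperHalfPlane

open scoped UpperHalfPlane

noncomputable section

instance : MeasurableSpace ℍ := borel ℍ

instance : BorelSpace ℍ := ⟨rfl⟩

/-- The hyperbolic area measure on the upper half-plane: the measure with density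
`y⁻²` with respect to the planar Lebesgue measure. -/
def hypAreaMeasure : Measure ℍ :=
  (Measure.comap (fun z : ℍ => (z : ℂ)) volume).withDensity
    (fun z => ENNReal.ofReal ((z.im ^ 2)⁻¹))

/-- The hyperbolic area of a subset of the hyperbolic plane. -/
def hypArea (K : Set ℍ) : ℝ := (hypAreaMeasure K).toReal

/-- The hyperbolic perimeter: one-dimensional Hausdorff measure (with respect to the
hyperbolic metric) of the topological boundary. -/
def hypPerim (K : Set ℍ) : ℝ := (μH[1] (frontier K)).toReal

/-- Geodesic convexity in the hyperbolic plane. -/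
def HypConvex (K : Set ℍ) : Prop :=
  ∀ x ∈ K, ∀ y ∈ K, ∀ z : ℍ, dist x z + dist z y = dist x y → z ∈ K

/-- The hyperbolic circumradius of `K`. -/
def hypCircumradius (K : Set ℍ) : ℝ :=
  sInf {R : ℝ | ∃ c : ℍ, K ⊆ Metric.closedBall c R}

/-- The hyperbolic inradius of `K`. -/
def hypInradius (K : Set ℍ) : ℝ :=
  sSup {r : ℝ | ∃ c : ℍ, Metric.closedBall c r ⊆ K}

/-- `K` is a closed hyperbolic disc of positive radius. -/
def IsHypDisc (K : Set ℍ) : Prop :=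
  ∃ (c : ℍ) (r : ℝ), 0 < r ∧ K = Metric.closedBall c r

end


/-- crossing event -/
noncomputable def arcY (C S e X V x : ℝ) : ℝ := C / V - e * √(S ^ 2 / V ^ 2 - (x - X) ^ 2)

def linkE (C S e : ℝ) (p q : ℝ × ℝ) : Set (ℝ × ℝ) :=
  {c | 0 < c.2 ∧ |p.1 - c.1| < S / c.2 ∧ |q.1 - c.1| < S / c.2 ∧
    (p.2 - arcY C S e c.1 c.2 p.1) * (q.2 - arcY C S e c.1 c.2 q.1) ≤ 0}

lemma measurableSet_linkE (C S e : ℝ) (p q : ℝ × ℝ) : MeasurableSet (linkE C S e p q) := by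
  have h1 : MeasurableSet {c : ℝ × ℝ | 0 < c.2} :=
    measurableSet_lt measurable_const measurable_snd
  have h2 (x : ℝ) : MeasurableSet {c : ℝ × ℝ | |x - c.1| < S / c.2} := by
    refine measurableSet_lt ?_ ?_
    · exact (measurable_const.sub measurable_fst).abs
    · fun_prop
  have h3 : MeasurableSet {c : ℝ × ℝ | (p.2 - arcY C S e c.1 c.2 p.1) *
      (q.2 - arcY C S e c.1 c.2 q.1) ≤ 0} := by
    unfold arcY
    exact measurableSet_le (by fun_prop) measurable_const
  exact h1.inter ((h2 p.1).inter ((h2 q.1).inter h3))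

lemma integral_abs_cos_shift (φ : ℝ) : ∫ t in (-(π/2))..(π/2), |cos (t + φ)| = 2 := by
  have hper : Function.Periodic (fun t => |cos t|) π := by
    intro t; simp [Real.cos_add_pi]
  have h1 : ∫ t in (-(π/2))..(π/2), |cos (t + φ)| = ∫ t in (-(π/2)+φ)..(-(π/2)+φ+π), |cos t| := by
    rw [intervalIntegral.integral_comp_add_right (fun t => |cos t|)]
    congr 1; ring
  rw [h1, hper.intervalIntegral_add_eq (-(π/2)+φ) (-(π/2))]
  have h2 : ∫ t in (-(π/2))..(-(π/2)+π), |cos t| = ∫ t in (-(π/2))..(π/2), cos t := by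
    rw [show -(π/2)+π = π/2 by ring]
    apply intervalIntegral.integral_congr
    intro t ht
    rw [Set.uIcc_of_le (by linarith [pi_pos])] at ht
    exact abs_of_nonneg (cos_nonneg_of_mem_Icc ht)
  rw [h2]; simp; norm_num

lemma integral_abs_lin (a b : ℝ) :
    ∫ t in (-(π/2))..(π/2), |a * sin t - b * cos t| = 2 * √(a^2+b^2) := by
  -- a sin t - b cos t = Re ((-b - a i) ... )
  set z : ℂ := ⟨-b, a⟩ with hz
  have hn : ‖z‖ = √(a^2+b^2) := by
    rw [Complex.norm_eq_sqrt_sq_add_sq, hz]; simp; ring_nf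
  have hre : ‖z‖ * cos z.arg = -b := Complex.norm_mul_cos_arg z
  have him : ‖z‖ * sin z.arg = a := Complex.norm_mul_sin_arg z
  have h : ∀ t, |a * sin t - b * cos t| = √(a^2+b^2) * |cos (t + (-z.arg))| := by
    intro t
    rw [← hn, ← abs_of_nonneg (norm_nonneg z), ← abs_mul]
    congr 1
    rw [← sub_eq_add_neg, cos_sub, mul_add]
    linear_combination (-sin t) * him - cos t * hre
  simp_rw [h]
  rw [intervalIntegral.integral_const_mul, integral_abs_cos_shift]; ring

/-- The parametrization of crossing centers. -/
noncomputable def linkG (C S e : ℝ) (x0 y0 x' y' : ℝ) (u : ℝ × ℝ) : ℝ × ℝ :=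
  ((x0 + u.1 * x') - S * (y0 + u.1 * y') * sin u.2 / (C - e * S * cos u.2),
    (C - e * S * cos u.2) / (y0 + u.1 * y'))

lemma linkG_hasFDerivAt (C S e x0 y0 x' y' : ℝ) (u : ℝ × ℝ)
    (hm : C - e * S * cos u.2 ≠ 0) (hy : y0 + u.1 * y' ≠ 0) :
    HasFDerivAt (linkG C S e x0 y0 x' y')
      (Matrix.toLin (.finTwoProd ℝ) (.finTwoProd ℝ)
        !![x' - S * y' * sin u.2 / (C - e * S * cos u.2),
          -(S * (y0 + u.1 * y') * (C * cos u.2 - e * S) / (C - e * S * cos u.2) ^ 2);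
          -((C - e * S * cos u.2) * y' / (y0 + u.1 * y') ^ 2),
          e * S * sin u.2 / (y0 + u.1 * y')]).toContinuousLinearMap u := by
  rw [Matrix.toLin_finTwoProd_toContinuousLinearMap]
  have f1 : HasFDerivAt (fun u : ℝ × ℝ => u.1) (ContinuousLinearMap.fst ℝ ℝ ℝ) u := hasFDerivAt_fst
  have f2 : HasFDerivAt (fun u : ℝ × ℝ => u.2) (ContinuousLinearMap.snd ℝ ℝ ℝ) u := hasFDerivAt_snd
  have hs := f2.sin
  have hc := f2.cos
  have hmd := (hc.const_mul (e * S)).const_sub C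
  have hyd := (f1.mul_const y').const_add y0
  have hxd := (f1.mul_const x').const_add x0
  have hmi := (hasDerivAt_inv hm).comp_hasFDerivAt u hmd
  have hyi := (hasDerivAt_inv hy).comp_hasFDerivAt u hyd
  have hA := hxd.sub (((hyd.const_mul S).mul hs).mul hmi)
  have hB := hmd.mul hyi
  have hAB := hA.prodMk hB
  refine (hAB.congr_fderiv ?_)
  have key : sin u.2 ^ 2 = 1 - cos u.2 ^ 2 := Real.sin_sq u.2
  ext
  · simp
    field_simp
  · simp
    field_simp
  · simp
    field_simp
    linear_combination (e * S ^ 2) * key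
  · simp
    field_simp

lemma linkG_det (C S e y0 x' y' : ℝ) (u : ℝ × ℝ)
    (hm : C - e * S * cos u.2 ≠ 0) (hy : y0 + u.1 * y' ≠ 0) :
      (Matrix.toLin (.finTwoProd ℝ) (.finTwoProd ℝ)
        !![x' - S * y' * sin u.2 / (C - e * S * cos u.2),
          -(S * (y0 + u.1 * y') * (C * cos u.2 - e * S) / (C - e * S * cos u.2) ^ 2);
          -((C - e * S * cos u.2) * y' / (y0 + u.1 * y') ^ 2),
          e * S * sin u.2 / (y0 + u.1 * y')]).toContinuousLinearMap.det =
      S * ((e * x') * sin u.2 - y' * cos u.2) / (y0 + u.1 * y') := by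
  rw [LinearMap.det_toContinuousLinearMap, LinearMap.det_toLin, Matrix.det_fin_two_of]
  have key : sin u.2 ^ 2 = 1 - cos u.2 ^ 2 := Real.sin_sq u.2
  generalize hM : C - e * S * cos u.2 = M at *
  generalize hY : y0 + u.1 * y' = Y at *
  obtain rfl : C = M + e * S * cos u.2 := by linarith
  field_simp
  linear_combination (-(e * S ^ 2 * y')) * key

lemma vol_linkE_aux (C S e : ℝ) (he : e ^ 2 = 1) (hS : 0 < S) (hSC : S < C) (p q : ℝ × ℝ)
    (m : ℝ) (hm : 0 < m) (hp : m ≤ p.2) (hq : m ≤ q.2) :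
    volume (linkE C S e p q) ≤
      ENNReal.ofReal (2 * S * √((q.1 - p.1) ^ 2 + (q.2 - p.2) ^ 2) / m) := by
  set x' := q.1 - p.1 with hx'
  set y' := q.2 - p.2 with hy'
  have hdom : ∀ s ∈ Set.Icc (0:ℝ) 1, m ≤ p.2 + s * y' := by
    intro s hs
    have : p.2 + s * y' = (1 - s) * p.2 + s * q.2 := by rw [hy']; ring
    rw [this]
    nlinarith [hs.1, hs.2, mul_le_mul_of_nonneg_left hp (sub_nonneg.2 hs.2),
      mul_le_mul_of_nonneg_left hq hs.1]
  have hden : ∀ t : ℝ, 0 < C - e * S * cos t := by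
    intro t
    have h1 : (e * cos t) ^ 2 ≤ 1 := by
      rw [mul_pow, he, one_mul]; exact Real.cos_sq_le_one t
    have h2 : e * cos t ≤ 1 := (abs_le_one_iff_mul_self_le_one.2 (by nlinarith) |> abs_le.1).2
    nlinarith
  set D : Set (ℝ × ℝ) := Set.Icc (0:ℝ) 1 ×ˢ Set.Icc (-(π/2)) (π/2) with hD
  have hDm : MeasurableSet D := measurableSet_Icc.prod measurableSet_Icc
  have hsub : linkE C S e p q ⊆ (linkG C S e p.1 p.2 x' y') '' D := by
    rintro ⟨X, V⟩ ⟨hV, h1, h2, h3⟩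
    simp only at hV h1 h2 h3
    set f : ℝ → ℝ := fun s => (p.2 + s * y') - arcY C S e X V (p.1 + s * x') with hf
    have hfc : ContinuousOn f (Set.uIcc 0 1) := by
      apply Continuous.continuousOn; unfold f arcY; fun_prop
    have h0 : f 0 = p.2 - arcY C S e X V p.1 := by simp [hf]
    have h1' : f 1 = q.2 - arcY C S e X V q.1 := by simp [hf, hx', hy']
    have hz : (0:ℝ) ∈ Set.uIcc (f 0) (f 1) := by
      rw [h0, h1', Set.mem_uIcc]
      by_contra hcon
      push Not at hcon
      rcases lt_trichotomy 0 (p.2 - arcY C S e X V p.1) with h | h | h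
      · have := hcon.2
        rcases le_or_gt (q.2 - arcY C S e X V q.1) 0 with h' | h'
        · linarith [hcon.2 h']
        · nlinarith
      · rcases le_or_gt (q.2 - arcY C S e X V q.1) 0 with h' | h'
        · linarith [hcon.2 h']
        · linarith [hcon.1 h.symm.le]
      · have := hcon.1 h.le
        nlinarith
    obtain ⟨s, hs, hs0⟩ := intermediate_value_uIcc hfc hz
    rw [Set.uIcc_of_le zero_le_one] at hs
    set x := p.1 + s * x' with hx
    set y := p.2 + s * y' with hy
    have hyp : 0 < y := lt_of_lt_of_le hm (hdom s hs)
    have hxX : |x - X| < S / V := by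
      have : x - X = (1 - s) * (p.1 - X) + s * (q.1 - X) := by rw [hx, hx']; ring
      rw [abs_lt] at *
      rw [this]
      constructor <;> rcases hs.1.eq_or_lt with h | h
      · rw [← h]; linarith
      · nlinarith [hs.2]
      · rw [← h]; linarith
      · nlinarith [hs.2]
    have hw : |V * (x - X) / S| < 1 := by
      rw [abs_div, abs_mul, abs_of_pos hV, abs_of_pos hS, div_lt_one hS]
      rwa [lt_div_iff₀ hV, mul_comm] at hxX
    refine ⟨(s, arcsin (V * (x - X) / S)), ⟨hs, arcsin_mem_Icc _⟩, ?_⟩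
    have hsin : sin (arcsin (V * (x - X) / S)) = V * (x - X) / S :=
      sin_arcsin (abs_lt.1 hw).1.le (abs_lt.1 hw).2.le
    have hcos : cos (arcsin (V * (x - X) / S)) = V / S * √(S ^ 2 / V ^ 2 - (x - X) ^ 2) := by
      rw [cos_arcsin]
      conv_rhs => rw [← Real.sqrt_sq (show 0 ≤ V / S by positivity), ← Real.sqrt_mul (by positivity)]
      congr 1; field_simp
    have hfs : y = C / V - e * √(S ^ 2 / V ^ 2 - (x - X) ^ 2) := by
      have : f s = y - arcY C S e X V x := rfl
      rw [this, arcY] at hs0; linarith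
    have hVy : C - e * S * cos (arcsin (V * (x - X) / S)) = V * y := by
      rw [hcos, hfs]; field_simp
    unfold linkG
    simp only [← hx, ← hy, hVy, hsin]
    ext
    · simp; field_simp; ring
    · simp; field_simp
  calc volume (linkE C S e p q) ≤ volume ((linkG C S e p.1 p.2 x' y') '' D) := measure_mono hsub
    _ ≤ ∫⁻ u in D, ENNReal.ofReal |(Matrix.toLin (.finTwoProd ℝ) (.finTwoProd ℝ)
        !![x' - S * y' * sin u.2 / (C - e * S * cos u.2),
          -(S * (p.2 + u.1 * y') * (C * cos u.2 - e * S) / (C - e * S * cos u.2) ^ 2);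
          -((C - e * S * cos u.2) * y' / (p.2 + u.1 * y') ^ 2),
          e * S * sin u.2 / (p.2 + u.1 * y')]).toContinuousLinearMap.det| := by
        apply addHaar_image_le_lintegral_abs_det_fderiv volume hDm
        intro u hu
        exact (linkG_hasFDerivAt C S e p.1 p.2 x' y' u (hden _).ne'
          (lt_of_lt_of_le hm (hdom _ hu.1)).ne').hasFDerivWithinAt
    _ ≤ ∫⁻ u in D, ENNReal.ofReal (S / m * |(e * x') * sin u.2 - y' * cos u.2|) := by
        apply setLIntegral_mono' hDm
        intro u hu
        have hyu := hdom _ hu.1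
        rw [linkG_det _ _ _ _ _ _ _ (hden _).ne' (lt_of_lt_of_le hm hyu).ne']
        apply ENNReal.ofReal_le_ofReal
        rw [abs_div, abs_mul, abs_of_pos hS, abs_of_pos (lt_of_lt_of_le hm hyu), div_mul_eq_mul_div]
        gcongr
    _ = ∫⁻ t in Set.Icc (-(π/2)) (π/2), ENNReal.ofReal (S / m * |(e * x') * sin t - y' * cos t|) := by
        rw [hD, Measure.volume_eq_prod, ← Measure.prod_restrict,
          lintegral_prod _ (by fun_prop)]
        simp
    _ = ENNReal.ofReal (2 * S * √(x' ^ 2 + y' ^ 2) / m) := by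
        rw [← ofReal_integral_eq_lintegral_ofReal]
        · congr 1
          rw [integral_Icc_eq_integral_Ioc, ← intervalIntegral.integral_of_le (by linarith [pi_pos]),
            intervalIntegral.integral_const_mul, integral_abs_lin, mul_pow, he]
          ring_nf
        · exact (Continuous.continuousOn (by fun_prop)).integrableOn_Icc
        · exact Filter.Eventually.of_forall fun t => by positivity

/-- point of the upper half plane with given coordinates -/
noncomputable def hp (p : ℝ × ℝ) : ℍ := ofComplex ⟨p.1, p.2⟩

lemma hp_eq {p : ℝ × ℝ} (h : 0 < p.2) : hp p = UpperHalfPlane.mk ⟨p.1, p.2⟩ h :=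
  ofComplex_apply_of_im_pos h

lemma coe_hp {p : ℝ × ℝ} (h : 0 < p.2) : ((hp p : ℍ) : ℂ) = ⟨p.1, p.2⟩ := by
  rw [hp_eq h]

lemma hp_re {p : ℝ × ℝ} (h : 0 < p.2) : (hp p).re = p.1 := by
  rw [hp_eq h]; rfl

lemma hp_im {p : ℝ × ℝ} (h : 0 < p.2) : (hp p).im = p.2 := by
  rw [hp_eq h]; rfl

lemma hp_self (z : ℍ) : hp (z.re, z.im) = z := by
  rw [hp_eq z.im_pos]; rfl

lemma continuousOn_hp : ContinuousOn hp {p | 0 < p.2} := by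
  intro p h
  have h1 : ContinuousAt (fun p : ℝ × ℝ => (⟨p.1, p.2⟩ : ℂ)) p :=
    (Complex.equivRealProdCLM.symm.continuous).continuousAt
  have h2 : ContinuousAt (ofComplex : ℂ → ℍ) ⟨p.1, p.2⟩ := by
    exact (UpperHalfPlane.contMDiffAt_ofComplex (n := 0) (z := ⟨p.1, p.2⟩) h).continuousAt
  exact (ContinuousAt.comp (f := fun p : ℝ × ℝ => (⟨p.1, p.2⟩ : ℂ)) (x := p) h2 h1).continuousWithinAt

lemma eucl_le_im_exp (p q : ℝ × ℝ) (hp' : 0 < p.2) (hq : 0 < q.2) :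
    √((q.1 - p.1) ^ 2 + (q.2 - p.2) ^ 2) ≤ q.2 * (exp (dist (hp p) (hp q)) - 1) := by
  have h := UpperHalfPlane.dist_coe_le (hp p) (hp q)
  rw [coe_hp hp', coe_hp hq, hp_im hq, Complex.dist_eq_re_im] at h
  have h2 : (q.1 - p.1) ^ 2 + (q.2 - p.2) ^ 2 = (p.1 - q.1) ^ 2 + (p.2 - q.2) ^ 2 := by ring
  rw [h2]; exact h

lemma vol_linkE (r e : ℝ) (he : e ^ 2 = 1) (hr : 0 < r) (p q : ℝ × ℝ)
    (hp' : 0 < p.2) (hq : 0 < q.2) :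
    volume (linkE (cosh r) (sinh r) e p q) ≤
      ENNReal.ofReal (2 * sinh r * (exp (dist (hp p) (hp q)) - 1)) := by
  have hS : 0 < sinh r := Real.sinh_pos_iff.2 hr
  have hm : 0 < min p.2 q.2 := lt_min hp' hq
  refine (vol_linkE_aux (cosh r) (sinh r) e he hS (Real.sinh_lt_cosh r) p q _
    hm (min_le_left _ _) (min_le_right _ _)).trans (ENNReal.ofReal_le_ofReal ?_)
  rw [mul_div_assoc]
  gcongr
  rw [div_le_iff₀ hm]
  rcases le_total p.2 q.2 with h | h
  · rw [min_eq_left h]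
    have := eucl_le_im_exp q p hq hp'
    rw [dist_comm, mul_comm] at this
    refine le_trans (le_of_eq ?_) this
    congr 1; ring
  · rw [min_eq_right h, mul_comm]
    exact eucl_le_im_exp p q hp' hq


lemma edist_le_hausdorff_Ioo {X : Type*} [MetricSpace X] [MeasurableSpace X] [BorelSpace X]
    (γ : ℝ → X) (s s' : ℝ) (h : s ≤ s') (hc : ContinuousOn γ (Set.Icc s s')) :
    ENNReal.ofReal (dist (γ s) (γ s')) ≤ μH[1] (γ '' Set.Ioo s s') := by
  set g : X → ℝ := fun x => dist (γ s) x with hg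
  have hl : LipschitzWith 1 g := LipschitzWith.dist_right _
  have h1 : Set.Ioo (0:ℝ) (dist (γ s) (γ s')) ⊆ g '' (γ '' Set.Ioo s s') := by
    have := intermediate_value_Ioo h (f := fun t => g (γ t)) (hl.continuous.comp_continuousOn hc)
    rw [Set.image_image]
    simpa [hg] using this
  calc ENNReal.ofReal (dist (γ s) (γ s')) = volume (Set.Ioo (0:ℝ) (dist (γ s) (γ s'))) := by simp
    _ = μH[1] (Set.Ioo (0:ℝ) (dist (γ s) (γ s'))) := by rw [hausdorffMeasure_real]
    _ ≤ μH[1] (g '' (γ '' Set.Ioo s s')) := measure_mono h1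
    _ ≤ (1:NNReal) ^ (1:ℝ) * μH[1] (γ '' Set.Ioo s s') := hl.hausdorffMeasure_image_le zero_le_one _
    _ = _ := by simp

lemma sum_dist_le_hausdorff {X : Type*} [MetricSpace X] [MeasurableSpace X] [BorelSpace X]
    (γ : ℝ → X) (t0 t1 : ℝ) (hc : ContinuousOn γ (Set.Icc t0 t1))
    (hi : Set.InjOn γ (Set.Ioo t0 t1)) (t : ℕ → ℝ) (ht : Monotone t) (n : ℕ)
    (h0 : t0 ≤ t 0) (h1 : t n ≤ t1) :
    ∑ j ∈ Finset.range n, ENNReal.ofReal (dist (γ (t j)) (γ (t (j+1)))) ≤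
      μH[1] (γ '' Set.Ioo t0 t1) := by
  have hsub : ∀ j ∈ Finset.range n, Set.Icc (t j) (t (j+1)) ⊆ Set.Icc t0 t1 := by
    intro j hj
    apply Set.Icc_subset_Icc (h0.trans (ht (Nat.zero_le _)))
    exact (ht (Finset.mem_range.1 hj)).trans h1
  have hsub' : ∀ j ∈ Finset.range n, Set.Ioo (t j) (t (j+1)) ⊆ Set.Ioo t0 t1 := by
    intro j hj
    apply Set.Ioo_subset_Ioo (h0.trans (ht (Nat.zero_le _)))
    exact (ht (Finset.mem_range.1 hj)).trans h1
  calc _ ≤ ∑ j ∈ Finset.range n, μH[1] (γ '' Set.Ioo (t j) (t (j+1))) := by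
        apply Finset.sum_le_sum
        intro j hj
        exact edist_le_hausdorff_Ioo γ _ _ (ht (Nat.le_succ j)) (hc.mono (hsub j hj))
    _ = μH[1] (⋃ j ∈ Finset.range n, γ '' Set.Ioo (t j) (t (j+1))) := by
        rw [measure_biUnion_finset]
        · intro i hi' j hj hij
          rw [Function.onFun, Set.disjoint_left]
          rintro _ ⟨a, ha, rfl⟩ ⟨b, hb, hab⟩
          have hba : b = a := hi (hsub' j hj hb) (hsub' i hi' ha) hab
          subst hba
          rcases lt_or_gt_of_ne hij with h | h
          · have := ht (Nat.succ_le_of_lt h)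
            simp only [Nat.succ_eq_add_one] at this
            linarith [ha.2, hb.1]
          · have := ht (Nat.succ_le_of_lt h)
            simp only [Nat.succ_eq_add_one] at this
            linarith [hb.2, ha.1]
        · intro j hj
          exact measurableSet_Ioo.image_of_continuousOn_injOn (hc.mono (Set.Ioo_subset_Icc_self.trans (hsub j hj))) (hi.mono (hsub' j hj))
    _ ≤ _ := by
        apply measure_mono
        refine Set.iUnion₂_subset fun j hj => Set.image_mono (hsub' j hj)


lemma arctan_exp_add (r : ℝ) : arctan (exp r) + arctan (exp (-r)) = π / 2 := by
  rw [Real.exp_neg, Real.arctan_inv_of_pos (exp_pos r)]; ring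

lemma ball_integral (r : ℝ) (hr : 0 < r) :
    ∫ t in (-(π/2))..(π/2), 2 * (sinh r ^ 2 * cos t ^ 2 / (cosh r + sinh r * sin t)) =
      2 * π * (cosh r - 1) := by
  set C := cosh r with hC
  set S := sinh r with hS
  have hCS : C ^ 2 = 1 + S ^ 2 := by rw [hC, hS, Real.cosh_sq]; ring
  have hSpos : 0 < S := Real.sinh_pos_iff.2 hr
  have hlt : S < C := Real.sinh_lt_cosh r
  have hden : ∀ t : ℝ, 0 < C + S * sin t := by
    intro t; nlinarith [Real.neg_one_le_sin t]
  have hd : ∀ t ∈ Set.uIcc (-(π/2)) (π/2), HasDerivAt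
      (fun t => 2 * (C * t + S * cos t - 2 * arctan (C * tan (t / 2) + S)))
      (2 * (S ^ 2 * cos t ^ 2 / (C + S * sin t))) t := by
    intro t ht
    rw [Set.uIcc_of_le (by linarith [pi_pos])] at ht
    have hc : 0 < cos (t / 2) := by
      apply cos_pos_of_mem_Ioo
      constructor <;> linarith [ht.1, ht.2, pi_pos]
    have h1 : HasDerivAt (fun t => tan (t / 2)) (1 / cos (t/2) ^ 2 * (1 / 2)) t :=
      HasDerivAt.comp t (Real.hasDerivAt_tan hc.ne') ((hasDerivAt_id t).div_const 2)
    have h2 := ((h1.const_mul C).add_const S).arctan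
    have h3 := ((((hasDerivAt_id t).const_mul C).add ((hasDerivAt_cos t).const_mul S)).sub
      (h2.const_mul 2)).const_mul 2
    refine h3.congr_deriv ?_
    have hd2 := hden t
    have hs : sin t = 2 * sin (t/2) * cos (t/2) := by
      rw [← Real.sin_two_mul]; congr 1; ring
    have hcc : cos t ^ 2 = 1 - sin t ^ 2 := Real.cos_sq' t
    rw [hcc, Real.tan_eq_sin_div_cos]
    have hs2 : sin (t/2) ^ 2 = 1 - cos (t/2)^2 := Real.sin_sq _
    rw [hs] at hd2 ⊢
    generalize sin (t/2) = s at *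
    generalize cos (t/2) = c at *
    have hD : 1 + (C * (s / c) + S) ^ 2 = C * (C + S * (2 * s * c)) / c ^ 2 := by
      field_simp
      linear_combination (C^2) * hs2 - (c ^2 ) * hCS
    rw [hD]
    have hCpos : 0 < C := hSpos.trans hlt
    generalize hDd : C + S * (2 * s * c) = D at *
    field_simp
    rw [← hDd]
    linear_combination hCS
  rw [intervalIntegral.integral_eq_sub_of_hasDerivAt hd]
  · have e1 : C + S = exp r := Real.cosh_add_sinh r
    have e2 : C - S = exp (-r) := Real.cosh_sub_sinh r
    have t1 : tan (π / 2 / 2) = 1 := by rw [show π/2/2 = π/4 by ring]; exact tan_pi_div_four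
    have t2 : tan (-(π / 2) / 2) = -1 := by rw [neg_div, tan_neg, t1]
    simp only [t1, t2, cos_neg, cos_pi_div_two]
    rw [show C * -1 + S = -(C - S) by ring, arctan_neg, mul_one, e1, e2]
    linear_combination (-4) * arctan_exp_add r
  · apply ContinuousOn.intervalIntegrable
    intro t _
    have := (hden t).ne'
    exact ContinuousAt.continuousWithinAt (by fun_prop (disch := assumption))

def ballE (C S : ℝ) (p : ℝ × ℝ) : Set (ℝ × ℝ) :=
  {c | 0 < c.2 ∧ (p.1 - c.1) ^ 2 + (p.2 - C / c.2) ^ 2 < (S / c.2) ^ 2}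

lemma measurableSet_ballE (C S : ℝ) (p : ℝ × ℝ) : MeasurableSet (ballE C S p) := by
  have h1 : MeasurableSet {c : ℝ × ℝ | 0 < c.2} :=
    measurableSet_lt measurable_const measurable_snd
  have h2 : MeasurableSet {c : ℝ × ℝ | (p.1 - c.1) ^ 2 + (p.2 - C / c.2) ^ 2 < (S / c.2) ^ 2} := by
    refine measurableSet_lt ?_ ?_
    · refine Measurable.add ?_ ?_
      · exact (measurable_const.sub measurable_fst).pow_const 2
      · exact (measurable_const.sub (measurable_const.div measurable_snd)).pow_const 2
    · exact (measurable_const.div measurable_snd).pow_const 2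
  exact h1.inter h2

lemma vol_ballE (r : ℝ) (hr : 0 < r) (p : ℝ × ℝ) (hp : 0 < p.2) :
    volume (ballE (cosh r) (sinh r) p) = ENNReal.ofReal (2 * π * (cosh r - 1)) := by
  rw [← ball_integral r hr]
  set C := cosh r with hC
  set S := sinh r with hS
  have hSpos : 0 < S := Real.sinh_pos_iff.2 hr
  have hlt : S < C := Real.sinh_lt_cosh r
  have hden : ∀ t : ℝ, 0 < C + S * sin t := by
    intro t; nlinarith [Real.neg_one_le_sin t]
  obtain ⟨x0, y0⟩ := p
  simp only at hp
  set g : ℝ → ℝ := fun V => √(S ^ 2 - (y0 * V - C) ^ 2) / V with hg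
  set V1 := (C - S) / y0 with hV1
  set V2 := (C + S) / y0 with hV2
  have hV1p : 0 < V1 := div_pos (by linarith) hp
  have hV12 : V1 ≤ V2 := by rw [hV1, hV2]; gcongr; linarith
  have hE : ballE C S (x0, y0) = Prod.swap ⁻¹' regionBetween (fun V => x0 - g V) (fun V => x0 + g V)
      (Set.Ioc V1 V2) := by
    ext ⟨X, V⟩
    simp only [ballE, Set.mem_ofPred_eq, Set.mem_preimage, regionBetween, Prod.swap, Set.mem_Ioo, Set.mem_Ioc]
    constructor
    · rintro ⟨hV, h⟩
      have h' : (V * (x0 - X)) ^ 2 < S ^ 2 - (y0 * V - C) ^ 2 := by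
        have := mul_lt_mul_of_pos_left h (pow_pos hV 2)
        have e1 : V ^ 2 * ((x0 - X) ^ 2 + (y0 - C / V) ^ 2) = (V * (x0 - X)) ^ 2 + (y0 * V - C) ^ 2 := by
          field_simp
        have e2 : V ^ 2 * (S / V) ^ 2 = S ^ 2 := by field_simp
        rw [e1, e2] at this; linarith
      have h3 : |V * (x0 - X)| < √(S ^ 2 - (y0 * V - C) ^ 2) := Real.lt_sqrt_of_sq_lt (by rwa [sq_abs])
      rw [abs_mul, abs_of_pos hV, ← lt_div_iff₀' hV, abs_lt] at h3
      have h4 : |y0 * V - C| < S := abs_lt_of_sq_lt_sq (by nlinarith [sq_nonneg (V * (x0 - X))]) hSpos.le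
      rw [abs_lt] at h4
      refine ⟨⟨?_, ?_⟩, ?_, ?_⟩
      · rw [hV1, div_lt_iff₀ hp]; linarith
      · rw [hV2, le_div_iff₀ hp]; linarith
      · simp only [hg]; linarith
      · simp only [hg]; linarith
    · rintro ⟨⟨h1, h2⟩, h3, h4⟩
      have hV : 0 < V := hV1p.trans h1
      refine ⟨hV, ?_⟩
      have h5 : |x0 - X| < g V := by rw [abs_lt]; constructor <;> linarith
      simp only [hg] at h5
      rw [lt_div_iff₀ hV] at h5
      have h6 := (Real.lt_sqrt (by positivity)).1 h5
      rw [mul_pow, sq_abs] at h6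
      rw [← mul_lt_mul_iff_right₀ (pow_pos hV 2)]
      have e1 : V ^ 2 * ((x0 - X) ^ 2 + (y0 - C / V) ^ 2) = (V * (x0 - X)) ^ 2 + (y0 * V - C) ^ 2 := by
        field_simp
      have e2 : V ^ 2 * (S / V) ^ 2 = S ^ 2 := by field_simp
      rw [e1, e2]; linarith
  have hgc : ContinuousOn g (Set.Icc V1 V2) := by
    intro V hV
    have : V ≠ 0 := (hV1p.trans_le hV.1).ne'
    exact ContinuousAt.continuousWithinAt (by unfold g; fun_prop (disch := assumption))
  have hm : NullMeasurableSet (regionBetween (fun V => x0 - g V) (fun V => x0 + g V)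
      (Set.Ioc V1 V2)) := by
    apply MeasurableSet.nullMeasurableSet
    apply measurableSet_regionBetween _ _ measurableSet_Ioc <;> unfold g <;> fun_prop
  rw [hE]
  have hsw : MeasurePreserving (Prod.swap : ℝ × ℝ → ℝ × ℝ) volume volume :=
    Measure.measurePreserving_swap
  rw [hsw.measure_preimage hm, Measure.volume_eq_prod, volume_regionBetween_eq_integral]
  · congr 1
    rw [← intervalIntegral.integral_of_le hV12]
    have hsub := intervalIntegral.integral_comp_mul_deriv' (a := -(π/2)) (b := π/2)
      (f := fun t => (C + S * sin t) / y0) (f' := fun t => S * cos t / y0)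
      (g := ((fun V => x0 + g V) - fun V => x0 - g V)) ?_ ?_ ?_
    · simp only [sin_neg, sin_pi_div_two, mul_one, mul_neg] at hsub
      rw [← sub_eq_add_neg] at hsub
      rw [← hsub]
      apply intervalIntegral.integral_congr
      intro t ht
      rw [Set.uIcc_of_le (by linarith [pi_pos])] at ht
      have hc : 0 ≤ cos t := cos_nonneg_of_mem_Icc ht
      have hd := hden t
      simp only [Function.comp, Pi.sub_apply, hg]
      have : S ^ 2 - (y0 * ((C + S * sin t) / y0) - C) ^ 2 = (S * cos t) ^ 2 := by
        rw [mul_div_cancel₀ _ hp.ne', mul_pow S (cos t), Real.cos_sq']; ring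
      rw [this, Real.sqrt_sq (by positivity)]
      field_simp
      ring
    · intro t _
      exact ((((hasDerivAt_sin t).const_mul S).const_add C).div_const y0)
    · exact Continuous.continuousOn (by fun_prop)
    · apply ContinuousOn.mono (s := Set.Icc V1 V2)
      · exact (continuousOn_const.add hgc).sub (continuousOn_const.sub hgc)
      · rintro _ ⟨t, _, rfl⟩
        constructor
        · rw [hV1]; simp only; gcongr; nlinarith [Real.neg_one_le_sin t]
        · rw [hV2]; simp only; gcongr; nlinarith [Real.sin_le_one t]
  · exact ((continuousOn_const.sub hgc).integrableOn_Icc).mono_set Set.Ioc_subset_Icc_self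
  · exact ((continuousOn_const.add hgc).integrableOn_Icc).mono_set Set.Ioc_subset_Icc_self
  · exact measurableSet_Ioc
  · intro V hV
    have : 0 ≤ g V := div_nonneg (Real.sqrt_nonneg _) (hV1p.trans hV.1).le
    linarith


def tipE (C S e : ℝ) (U : Set (ℝ × ℝ)) : Set (ℝ × ℝ) :=
  {c | 0 < c.2 ∧ (c.1 - e * S / c.2, C / c.2) ∈ U}

lemma measurableSet_tipE (C S e : ℝ) (U : Set (ℝ × ℝ)) (hU : MeasurableSet U) :
    MeasurableSet (tipE C S e U) := by
  have h1 : MeasurableSet {c : ℝ × ℝ | 0 < c.2} :=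
    measurableSet_lt measurable_const measurable_snd
  have h2 : Measurable (fun c : ℝ × ℝ => (c.1 - e * S / c.2, C / c.2)) := by fun_prop
  exact h1.inter (h2 hU)

lemma vol_tipE (C S e : ℝ) (hC : 0 < C) (U : Set (ℝ × ℝ)) (hU : MeasurableSet U)
    (hpos : ∀ p ∈ U, 0 < p.2) :
    volume (tipE C S e U) = ENNReal.ofReal C * ∫⁻ p in U, ENNReal.ofReal ((p.2 ^ 2)⁻¹) := by
  set Ψ : ℝ × ℝ → ℝ × ℝ := fun p => (p.1 + e * S / C * p.2, C * p.2⁻¹) with hΨ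
  have himg : tipE C S e U = Ψ '' U := by
    ext ⟨X, V⟩
    constructor
    · rintro ⟨hV, h⟩
      refine ⟨_, h, ?_⟩
      simp only at hV
      simp only [hΨ]
      ext
      · simp; field_simp; ring
      · simp; field_simp
    · rintro ⟨⟨x, y⟩, h, hxy⟩
      have hy : 0 < y := hpos _ h
      simp only [hΨ, Prod.mk.injEq] at hxy
      obtain ⟨rfl, rfl⟩ := hxy
      refine ⟨by simp only; positivity, ?_⟩
      have : (x + e * S / C * y - e * S / (C * y⁻¹), C / (C * y⁻¹)) = (x, y) := by
        ext
        · simp; field_simp; ring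
        · simp; field_simp
      simp only
      rw [this]; exact h
  have hinj : Set.InjOn Ψ U := by
    rintro ⟨x, y⟩ h ⟨x', y'⟩ h' hh
    have hy : 0 < y := hpos _ h
    have hy' : 0 < y' := hpos _ h'
    simp only [hΨ, Prod.mk.injEq] at hh
    have h2 : y = y' := by
      have := mul_left_cancel₀ hC.ne' hh.2
      exact inv_injective this
    subst h2
    ext
    · simpa using hh.1
    · rfl
  have hd : ∀ p ∈ U, HasFDerivWithinAt Ψ (Matrix.toLin (.finTwoProd ℝ) (.finTwoProd ℝ)
        !![1, e * S / C; 0, -(C * (p.2 ^ 2)⁻¹)]).toContinuousLinearMap U p := by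
    intro p hp
    have hy := hpos p hp
    rw [Matrix.toLin_finTwoProd_toContinuousLinearMap]
    apply HasFDerivAt.hasFDerivWithinAt
    have f1 : HasFDerivAt (fun u : ℝ × ℝ => u.1) (ContinuousLinearMap.fst ℝ ℝ ℝ) p := hasFDerivAt_fst
    have f2 : HasFDerivAt (fun u : ℝ × ℝ => u.2) (ContinuousLinearMap.snd ℝ ℝ ℝ) p := hasFDerivAt_snd
    have h := (f1.add (f2.const_mul (e * S / C))).prodMk
      (((hasDerivAt_inv hy.ne').comp_hasFDerivAt p f2).const_mul C)
    refine h.congr_fderiv ?_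
    ext <;> simp
  rw [himg, ← lintegral_abs_det_fderiv_eq_addHaar_image volume hU hd hinj,
    ← lintegral_const_mul' _ _ ENNReal.ofReal_ne_top]
  apply lintegral_congr
  intro p
  rw [LinearMap.det_toContinuousLinearMap, LinearMap.det_toLin, Matrix.det_fin_two_of,
    ← ENNReal.ofReal_mul hC.le]
  congr 1
  simp
  exact Or.inl hC.le

lemma vol_tipE_null (C S e : ℝ) (hC : 0 < C) (N : Set (ℝ × ℝ)) (hN : MeasurableSet N)
    (h0 : volume N = 0) : volume (tipE C S e N) = 0 := by
  have h1 : MeasurableSet {c : ℝ × ℝ | 0 < c.2} :=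
    measurableSet_lt measurable_const measurable_snd
  have : tipE C S e N = tipE C S e (N ∩ {c | 0 < c.2}) := by
    ext c
    simp only [tipE, Set.mem_ofPred_eq, Set.mem_inter_iff]
    constructor
    · rintro ⟨h, h'⟩; exact ⟨h, h', by positivity⟩
    · rintro ⟨h, h'⟩; exact ⟨h, h'.1⟩
  rw [this, vol_tipE C S e hC _ (hN.inter h1) (fun p hp => hp.2),
    setLIntegral_measure_zero _ _ (measure_mono_null Set.inter_subset_left h0), mul_zero]

lemma hypAreaMeasure_eq (K : Set ℍ) (hK : MeasurableSet K) (hC : MeasurableSet {p : ℝ × ℝ | 0 < p.2 ∧ hp p ∈ K}) :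
    hypAreaMeasure K = ∫⁻ p in {p : ℝ × ℝ | 0 < p.2 ∧ hp p ∈ K}, ENNReal.ofReal ((p.2 ^ 2)⁻¹) := by
  have hemb : MeasurableEmbedding (fun z : ℍ => (z : ℂ)) :=
    UpperHalfPlane.isOpenEmbedding_coe.measurableEmbedding
  rw [hypAreaMeasure, withDensity_apply _ hK]
  have e1 : ∫⁻ z in K, ENNReal.ofReal ((z.im ^ 2)⁻¹) ∂(Measure.comap (fun z : ℍ => (z : ℂ)) volume)
      = ∫⁻ w in (fun z : ℍ => (z : ℂ)) '' K, ENNReal.ofReal ((w.im ^ 2)⁻¹) := by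
    have h2 : (Measure.comap (fun z : ℍ => (z : ℂ)) volume).restrict K
      = Measure.comap (fun z : ℍ => (z : ℂ)) (volume.restrict ((fun z : ℍ => (z : ℂ)) '' K)) := by
      rw [hemb.comap_restrict, Set.preimage_image_eq _ hemb.injective]
    rw [h2]
    have h3 := hemb.lintegral_map (μ := Measure.comap (fun z : ℍ => (z : ℂ)) (volume.restrict ((fun z : ℍ => (z : ℂ)) '' K)))
      (fun w : ℂ => ENNReal.ofReal ((w.im ^ 2)⁻¹))
    rw [hemb.map_comap, Measure.restrict_restrict hemb.measurableSet_range,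
      Set.inter_eq_right.2 (Set.image_subset_range _ _)] at h3
    exact h3.symm
  rw [e1]
  have hmp := Complex.volume_preserving_equiv_real_prod
  have h4 := hmp.setLIntegral_comp_preimage hC (f := fun p => ENNReal.ofReal ((p.2 ^ 2)⁻¹)) (by fun_prop)
  rw [← h4]
  have h5 : Complex.measurableEquivRealProd ⁻¹' {p : ℝ × ℝ | 0 < p.2 ∧ hp p ∈ K} =
      (fun z : ℍ => (z : ℂ)) '' K := by
    ext w
    simp only [Set.mem_preimage, Set.mem_ofPred_eq, Complex.measurableEquivRealProd_apply, Set.mem_image]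
    constructor
    · rintro ⟨h, h'⟩
      exact ⟨_, h', coe_hp (p := (w.re, w.im)) h⟩
    · rintro ⟨z, hz, rfl⟩
      refine ⟨z.im_pos, ?_⟩
      have := hp_self z
      simp only [UpperHalfPlane.coe_re, UpperHalfPlane.coe_im]
      rwa [this]
  rw [h5]
  rfl


/-- grid points -/
noncomputable def grid (t0 t1 : ℝ) (n j : ℕ) : ℝ := t0 + j * ((t1 - t0) / n)

lemma grid_mono (t0 t1 : ℝ) (h : t0 ≤ t1) (n : ℕ) : Monotone (grid t0 t1 n) := by
  intro i j hij
  unfold grid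
  have : (0:ℝ) ≤ (t1 - t0) / n := div_nonneg (sub_nonneg.2 h) (Nat.cast_nonneg n)
  have hij' : (i:ℝ) ≤ j := by exact_mod_cast hij
  gcongr

lemma grid_zero (t0 t1 : ℝ) (n : ℕ) : grid t0 t1 n 0 = t0 := by simp [grid]

lemma grid_last_le (t0 t1 : ℝ) (h : t0 ≤ t1) (n : ℕ) : grid t0 t1 n n ≤ t1 := by
  unfold grid
  rcases Nat.eq_zero_or_pos n with rfl | hn
  · simpa using h
  · have : (n:ℝ) ≠ 0 := by positivity
    rw [mul_div_cancel₀ _ this]; linarith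

lemma grid_mem (t0 t1 : ℝ) (h : t0 ≤ t1) (n j : ℕ) (hj : j ≤ n) : grid t0 t1 n j ∈ Set.Icc t0 t1 :=
  ⟨(grid_zero t0 t1 n).symm.le.trans (grid_mono t0 t1 h n (Nat.zero_le j)),
    (grid_mono t0 t1 h n hj).trans (grid_last_le t0 t1 h n)⟩

lemma grid_approx (t0 t1 : ℝ) (h : t0 < t1) (s : ℝ) (hs : s ∈ Set.Icc t0 t1) :
    ∃ k : ℕ → ℕ, (∀ n, k n ≤ n) ∧ Filter.Tendsto (fun n => grid t0 t1 n (k n)) Filter.atTop (nhds s) := by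
  have hL : 0 < t1 - t0 := sub_pos.2 h
  set θ := (s - t0) / (t1 - t0) with hθ
  have hθ0 : 0 ≤ θ := div_nonneg (by linarith [hs.1]) hL.le
  have hθ1 : θ ≤ 1 := by rw [hθ, div_le_one hL]; linarith [hs.2]
  refine ⟨fun n => ⌊θ * n⌋₊, fun n => ?_, ?_⟩
  · apply Nat.floor_le_of_le
    nlinarith [Nat.cast_nonneg (α := ℝ) n]
  · have h1 : Filter.Tendsto (fun n : ℕ => ((⌊θ * n⌋₊ : ℕ) : ℝ) / n) Filter.atTop (nhds θ) :=
      (tendsto_nat_floor_mul_div_atTop hθ0).comp tendsto_natCast_atTop_atTop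
    have h2 := (h1.mul_const (t1 - t0)).const_add t0
    have h3 : t0 + θ * (t1 - t0) = s := by rw [hθ]; field_simp; ring
    rw [h3] at h2
    refine h2.congr fun n => ?_
    unfold grid; ring

lemma discrete_ivt (g : ℕ → ℝ) (i k : ℕ) (hik : i < k) (h : g i * g k < 0) :
    ∃ j, i ≤ j ∧ j < k ∧ g j * g (j+1) ≤ 0 := by
  by_contra hcon
  push Not at hcon
  have key : ∀ m, i + m ≤ k → 0 < g i * g (i + m) := by
    intro m
    induction m with
    | zero =>
      intro _
      have := hcon i le_rfl hik
      have hne : g i ≠ 0 := by rintro h0; rw [h0] at this; simp at this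
      simpa using mul_self_pos.2 hne
    | succ m ih =>
      intro hm
      have h1 := ih (by omega)
      have h2 := hcon (i + m) (by omega) (by omega)
      have h3 : 0 < (g i * g (i+m+1)) * (g (i+m))^2 := by nlinarith
      have h4 : 0 < g (i+m) ^ 2 := by
        have : g (i+m) ≠ 0 := by rintro h0; rw [h0] at h1; simp at h1
        positivity
      exact (pos_iff_pos_of_mul_pos h3).2 h4
  have := key (k - i) (by omega)
  rw [show i + (k - i) = k by omega] at this
  linarith

lemma exists_link (f : ℝ → ℝ) (hf : Continuous f) (t0 t1 s0 s1 : ℝ) (h0 : t0 ≤ s0)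
    (h1 : s1 ≤ t1) (hs : s0 < s1) (hlt : f s0 * f s1 < 0) :
    ∀ᶠ n : ℕ in Filter.atTop, ∃ j < n, s0 < grid t0 t1 n j ∧ grid t0 t1 n (j+1) < s1 ∧
      f (grid t0 t1 n j) * f (grid t0 t1 n (j+1)) ≤ 0 := by
  have ht : t0 < t1 := by linarith
  obtain ⟨u, hu1, hu2⟩ : ∃ u, u ∈ Set.Ioo s0 s1 ∧ f u * f s1 < 0 := by
    have e1 : ∀ᶠ u in nhdsWithin s0 (Set.Ioi s0), f u * f s1 < 0 :=
      nhdsWithin_le_nhds ((hf.mul continuous_const).continuousAt.eventually_lt continuousAt_const hlt)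
    have e2 : ∀ᶠ u in nhdsWithin s0 (Set.Ioi s0), u ∈ Set.Ioo s0 s1 := Ioo_mem_nhdsGT hs
    obtain ⟨u, hu⟩ := (e2.and e1).exists
    exact ⟨u, hu⟩
  obtain ⟨v, hv1, hv2⟩ : ∃ v, v ∈ Set.Ioo u s1 ∧ f u * f v < 0 := by
    have e1 : ∀ᶠ v in nhdsWithin s1 (Set.Iio s1), f u * f v < 0 :=
      nhdsWithin_le_nhds ((continuous_const.mul hf).continuousAt.eventually_lt continuousAt_const hu2)
    have e2 : ∀ᶠ v in nhdsWithin s1 (Set.Iio s1), v ∈ Set.Ioo u s1 := Ioo_mem_nhdsLT hu1.2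
    obtain ⟨v, hv⟩ := (e2.and e1).exists
    exact ⟨v, hv⟩
  obtain ⟨ku, hku, tu⟩ := grid_approx t0 t1 ht u ⟨h0.trans hu1.1.le, hu1.2.le.trans h1⟩
  obtain ⟨kv, hkv, tv⟩ := grid_approx t0 t1 ht v ⟨h0.trans (hu1.1.trans hv1.1).le, hv1.2.le.trans h1⟩
  have E1 := tu.eventually (lt_mem_nhds hu1.1)
  have E2 := tv.eventually (gt_mem_nhds hv1.2)
  have E3 := tu.eventually_lt tv hv1.1
  have E4 : ∀ᶠ n in Filter.atTop, f (grid t0 t1 n (ku n)) * f (grid t0 t1 n (kv n)) < 0 :=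
    (((hf.tendsto u).comp tu).mul ((hf.tendsto v).comp tv)).eventually (gt_mem_nhds hv2)
  filter_upwards [E1, E2, E3, E4] with n e1 e2 e3 e4
  have hm := grid_mono t0 t1 ht.le n
  have hk : ku n < kv n := by
    by_contra hc
    exact absurd (hm (not_lt.1 hc)) (not_le.2 e3)
  obtain ⟨j, hj1, hj2, hj3⟩ := discrete_ivt (fun j => f (grid t0 t1 n j)) _ _ hk e4
  exact ⟨j, lt_of_lt_of_le hj2 (hkv n), lt_of_lt_of_le e1 (hm hj1), lt_of_le_of_lt (hm hj2) e2, hj3⟩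

/-- crossing count -/
noncomputable def cnt (C S e : ℝ) (γ : ℝ → ℝ × ℝ) (t0 t1 : ℝ) (n : ℕ) (c : ℝ × ℝ) : ENNReal :=
  ∑ j ∈ Finset.range n,
    (linkE C S e (γ (grid t0 t1 n j)) (γ (grid t0 t1 n (j+1)))).indicator (fun _ => 1) c

/-- signed height of curve over the arc -/
noncomputable def sgnf (C S e : ℝ) (γ : ℝ → ℝ × ℝ) (c : ℝ × ℝ) (t : ℝ) : ℝ :=
  (γ t).2 - arcY C S e c.1 c.2 (γ t).1

lemma continuous_sgnf (C S e : ℝ) (γ : ℝ → ℝ × ℝ) (hγ : Continuous γ) (c : ℝ × ℝ) :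
    Continuous (sgnf C S e γ c) := by
  unfold sgnf arcY; fun_prop

lemma exists_link' (C S e : ℝ) (γ : ℝ → ℝ × ℝ) (hγ : Continuous γ) (c : ℝ × ℝ) (hc : 0 < c.2)
    (t0 t1 s0 s1 : ℝ) (h0 : t0 ≤ s0) (h1 : s1 ≤ t1) (hs : s0 < s1)
    (hJ : ∀ t ∈ Set.Ioo s0 s1, |(γ t).1 - c.1| < S / c.2)
    (hlt : sgnf C S e γ c s0 * sgnf C S e γ c s1 < 0) :
    ∀ᶠ n : ℕ in Filter.atTop, ∃ j < n, s0 < grid t0 t1 n j ∧ grid t0 t1 n (j+1) < s1 ∧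
      c ∈ linkE C S e (γ (grid t0 t1 n j)) (γ (grid t0 t1 n (j+1))) := by
  filter_upwards [exists_link _ (continuous_sgnf C S e γ hγ c) t0 t1 s0 s1 h0 h1 hs hlt] with n hn
  obtain ⟨j, hj, h2, h3, h4⟩ := hn
  have hle := grid_mono t0 t1 (by linarith) n (Nat.le_succ j)
  simp only [Nat.succ_eq_add_one] at hle
  exact ⟨j, hj, h2, h3, hc, hJ _ ⟨h2, by linarith⟩, hJ _ ⟨by linarith, h3⟩, h4⟩

lemma cnt_one (C S e : ℝ) (γ : ℝ → ℝ × ℝ) (hγ : Continuous γ) (c : ℝ × ℝ) (hc : 0 < c.2)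
    (t0 t1 s0 s1 : ℝ) (h0 : t0 ≤ s0) (h1 : s1 ≤ t1) (hs : s0 < s1)
    (hJ : ∀ t ∈ Set.Ioo s0 s1, |(γ t).1 - c.1| < S / c.2)
    (hlt : sgnf C S e γ c s0 * sgnf C S e γ c s1 < 0) :
    ∀ᶠ n : ℕ in Filter.atTop, 1 ≤ cnt C S e γ t0 t1 n c := by
  filter_upwards [exists_link' C S e γ hγ c hc t0 t1 s0 s1 h0 h1 hs hJ hlt] with n hn
  obtain ⟨j, hj, -, -, h4⟩ := hn
  unfold cnt
  refine le_trans ?_ (Finset.single_le_sum (fun _ _ => zero_le) (Finset.mem_range.2 hj))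
  simp [Set.indicator_of_mem h4]

lemma cnt_two (C S e : ℝ) (γ : ℝ → ℝ × ℝ) (hγ : Continuous γ) (c : ℝ × ℝ) (hc : 0 < c.2)
    (t0 t1 s0 s1 s2 : ℝ) (h0 : t0 ≤ s0) (h1 : s2 ≤ t1) (hs : s0 < s1) (hs' : s1 < s2)
    (hJ : ∀ t ∈ Set.Ioo s0 s2, |(γ t).1 - c.1| < S / c.2)
    (hlt : sgnf C S e γ c s0 * sgnf C S e γ c s1 < 0)
    (hlt' : sgnf C S e γ c s1 * sgnf C S e γ c s2 < 0) :
    ∀ᶠ n : ℕ in Filter.atTop, 2 ≤ cnt C S e γ t0 t1 n c := by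
  filter_upwards [exists_link' C S e γ hγ c hc t0 t1 s0 s1 h0 (by linarith) hs
      (fun t ht => hJ t ⟨ht.1, ht.2.trans hs'⟩) hlt,
    exists_link' C S e γ hγ c hc t0 t1 s1 s2 (by linarith) h1 hs'
      (fun t ht => hJ t ⟨hs.trans ht.1, ht.2⟩) hlt'] with n hn hn'
  obtain ⟨j, hj, -, h3, h4⟩ := hn
  obtain ⟨k, hk, h3', -, h4'⟩ := hn'
  have hjk : j ≠ k := by
    rintro rfl
    have hle := grid_mono t0 t1 (by linarith) n (Nat.le_succ j)
    simp only [Nat.succ_eq_add_one] at hle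
    linarith
  unfold cnt
  refine le_trans ?_ (Finset.sum_le_sum_of_subset (s := {j, k}) ?_)
  · rw [Finset.sum_pair hjk]
    simp [Set.indicator_of_mem h4, Set.indicator_of_mem h4']
    norm_num
  · intro i hi
    simp at hi
    rcases hi with rfl | rfl <;> simpa


def clampf (a b t : ℝ) : ℝ := max a (min b t)

def lowC (l : ℝ → ℝ) (t : ℝ) : ℝ × ℝ := (t, l t)

def uppC (a b : ℝ) (u : ℝ → ℝ) (t : ℝ) : ℝ × ℝ :=
  (clampf a b t, u (clampf a b t) - |t - clampf a b t|)

def bodyO (a b : ℝ) (l u : ℝ → ℝ) : Set (ℝ × ℝ) :=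
  {p | a < p.1 ∧ p.1 < b ∧ l p.1 < p.2 ∧ p.2 < u p.1}

def bodyC (a b : ℝ) (l u : ℝ → ℝ) : Set (ℝ × ℝ) :=
  {p | a ≤ p.1 ∧ p.1 ≤ b ∧ l p.1 ≤ p.2 ∧ p.2 ≤ u p.1}

lemma clampf_of_mem {a b t : ℝ} (h1 : a ≤ t) (h2 : t ≤ b) : clampf a b t = t := by
  simp [clampf, h1, h2]
lemma clampf_of_le {a b t : ℝ} (h1 : t ≤ a) (h2 : a ≤ b) : clampf a b t = a := by
  simp [clampf, h1, h1.trans h2]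
lemma clampf_of_ge {a b t : ℝ} (h1 : b ≤ t) (h2 : a ≤ b) : clampf a b t = b := by
  simp [clampf, h1, h2]

lemma uppC_of_mem {a b t : ℝ} (u : ℝ → ℝ) (h1 : a ≤ t) (h2 : t ≤ b) : uppC a b u t = (t, u t) := by
  simp [uppC, clampf_of_mem h1 h2]

lemma uppC_left {a b : ℝ} (l u : ℝ → ℝ) (h1 : l a ≤ u a) (h2 : a ≤ b) :
    uppC a b u (a - (u a - l a)) = (a, l a) := by
  rw [uppC, clampf_of_le (by linarith) h2]
  simp [abs_sub_comm (l a), abs_of_nonneg (sub_nonneg.2 h1)]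

lemma uppC_right {a b : ℝ} (l u : ℝ → ℝ) (h1 : l b ≤ u b) (h2 : a ≤ b) :
    uppC a b u (b + (u b - l b)) = (b, l b) := by
  rw [uppC, clampf_of_ge (by linarith) h2]
  simp [abs_of_nonneg (sub_nonneg.2 h1)]

lemma continuous_lowC (l : ℝ → ℝ) (hl : Continuous l) : Continuous (lowC l) := by
  unfold lowC; fun_prop

lemma continuous_uppC (a b : ℝ) (u : ℝ → ℝ) (hl : Continuous u) : Continuous (uppC a b u) := by
  unfold uppC clampf; fun_prop

lemma arcY_tip (C S e X V x : ℝ) (h : (x - X) ^ 2 = (S / V) ^ 2) : arcY C S e X V x = C / V := by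
  rw [arcY, h, div_pow]; simp

lemma leftEnd (C S : ℝ) (hS : 0 < S) (a b : ℝ) (hab : a < b) (l u : ℝ → ℝ)
    (hlu : ∀ x, a < x → x < b → l x < u x) (hlua : l a ≤ u a)
    (X V : ℝ) (hV : 0 < V) (hA : X - S / V ≠ a) (hA1 : C / V ≠ l (X - S / V))
    (hA2 : C / V ≠ u (X - S / V)) (hP : (a - X) ^ 2 + (l a - C / V) ^ 2 ≠ (S / V) ^ 2)
    (h1 : X - S / V < b) (h2 : a < X + S / V) :
    ∃ α αu : ℝ, a ≤ α ∧ α < b ∧ α < X + S / V ∧ (a - (u a - l a)) ≤ αu ∧ αu ≤ α ∧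
      (∀ t, α < t → X - S / V < t) ∧
      (∀ t, αu < t → X - S / V < clampf a b t) ∧
      α = max a (X - S / V) ∧
      (((X, V) ∈ tipE C S 1 (bodyO a b l u) ∧ (X, V) ∉ ballE C S (a, l a) ∧
          sgnf C S 1 (lowC l) (X, V) α < 0 ∧ 0 < sgnf C S (-1) (uppC a b u) (X, V) αu ∧ a < X - S / V) ∨
       ((X, V) ∉ tipE C S 1 (bodyO a b l u) ∧ (X, V) ∈ ballE C S (a, l a) ∧
          0 < sgnf C S 1 (lowC l) (X, V) α ∧ sgnf C S (-1) (uppC a b u) (X, V) αu < 0 ∧ X - S / V < a) ∨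
       ((X, V) ∉ tipE C S 1 (bodyO a b l u) ∧ (X, V) ∉ ballE C S (a, l a) ∧
          0 < sgnf C S 1 (lowC l) (X, V) α * sgnf C S (-1) (uppC a b u) (X, V) αu)) := by
  have hρ : 0 < S / V := div_pos hS hV
  set ρ := S / V with hρd
  set k := C / V with hk
  rcases lt_or_gt_of_ne hA with hlt | hgt
  · -- A < a
    refine ⟨a, a - (u a - l a), le_rfl, hab, h2, le_rfl, by linarith, fun t ht => by linarith,
      fun t _ => lt_of_lt_of_le hlt (le_max_left _ _), (max_eq_left hlt.le).symm, ?_⟩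
    have hq : 0 < ρ ^ 2 - (a - X) ^ 2 := by nlinarith
    set q := √(ρ ^ 2 - (a - X) ^ 2) with hqd
    have hqp : 0 < q := Real.sqrt_pos.2 hq
    have hq2 : q ^ 2 = ρ ^ 2 - (a - X) ^ 2 := Real.sq_sqrt hq.le
    have e1 : sgnf C S 1 (lowC l) (X, V) a = l a - k + q := by
      simp only [sgnf, lowC, arcY]
      rw [hqd, hρd, div_pow]; ring
    have e2 : sgnf C S (-1) (uppC a b u) (X, V) (a - (u a - l a)) = l a - k - q := by
      simp only [sgnf, arcY, uppC_left l u hlua hab.le]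
      rw [hqd, hρd, div_pow]; ring
    have n1 : (X, V) ∉ tipE C S 1 (bodyO a b l u) := by
      rintro ⟨_, h, _⟩
      simp only [one_mul] at h
      linarith
    rw [e1, e2]
    by_cases hb : (X, V) ∈ ballE C S (a, l a)
    · right; left
      have h3 := hb.2
      simp only [← hρd, ← hk] at h3
      have h4 : |l a - k| < q := abs_lt_of_sq_lt_sq (by linarith) hqp.le
      rw [abs_lt] at h4
      exact ⟨n1, hb, by linarith, by linarith, hlt⟩
    · right; right
      have h3 : ρ ^ 2 < (a - X) ^ 2 + (l a - k) ^ 2 :=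
        lt_of_le_of_ne (not_lt.1 fun h => hb ⟨hV, h⟩) hP.symm
      exact ⟨n1, hb, by nlinarith⟩
  · -- a < A
    refine ⟨X - ρ, X - ρ, hgt.le, h1, by linarith, by linarith, le_rfl, fun t ht => ht,
      fun t ht => lt_of_lt_of_le (lt_min h1 ht) (le_max_right _ _), (max_eq_right hgt.le).symm, ?_⟩
    have e1 : sgnf C S 1 (lowC l) (X, V) (X - ρ) = l (X - ρ) - k := by
      simp only [sgnf, lowC]
      rw [arcY_tip]; rw [← hρd]; ring
    have e2 : sgnf C S (-1) (uppC a b u) (X, V) (X - ρ) = u (X - ρ) - k := by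
      simp only [sgnf, uppC_of_mem u hgt.le h1.le]
      rw [arcY_tip]; rw [← hρd]; ring
    have n1 : (X, V) ∉ ballE C S (a, l a) := by
      rintro ⟨_, h⟩
      simp only [← hρd, ← hk] at h
      nlinarith [sq_nonneg (l a - k)]
    rw [e1, e2]
    have hl := hlu _ hgt h1
    by_cases hb : (X, V) ∈ tipE C S 1 (bodyO a b l u)
    · left
      obtain ⟨_, _, _, h3, h4⟩ := id hb
      simp only [one_mul, ← hρd, ← hk] at h3 h4
      exact ⟨hb, n1, by linarith, by linarith, hgt⟩
    · right; right
      refine ⟨hb, n1, ?_⟩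
      rcases lt_or_gt_of_ne hA1 with h3 | h3
      · exact mul_pos (by linarith) (by linarith)
      · rcases lt_or_gt_of_ne hA2 with h4 | h4
        · refine absurd ⟨hV, ?_⟩ hb
          simp only [one_mul, ← hρd, ← hk]
          exact ⟨hgt, h1, h3, h4⟩
        · exact mul_pos_of_neg_of_neg (by linarith) (by linarith)

lemma rightEnd (C S : ℝ) (hS : 0 < S) (a b : ℝ) (hab : a < b) (l u : ℝ → ℝ)
    (hlu : ∀ x, a < x → x < b → l x < u x) (hlub : l b ≤ u b)
    (X V : ℝ) (hV : 0 < V) (hA : X + S / V ≠ b) (hA1 : C / V ≠ l (X + S / V))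
    (hA2 : C / V ≠ u (X + S / V)) (hP : (b - X) ^ 2 + (l b - C / V) ^ 2 ≠ (S / V) ^ 2)
    (h1 : X - S / V < b) (h2 : a < X + S / V) :
    ∃ β βu : ℝ, β ≤ b ∧ a < β ∧ X - S / V < β ∧ βu ≤ (b + (u b - l b)) ∧ β ≤ βu ∧
      (∀ t, t < β → t < X + S / V) ∧
      (∀ t, t < βu → clampf a b t < X + S / V) ∧
      β = min b (X + S / V) ∧
      (((X, V) ∈ tipE C S (-1) (bodyO a b l u) ∧ (X, V) ∉ ballE C S (b, l b) ∧
          sgnf C S 1 (lowC l) (X, V) β < 0 ∧ 0 < sgnf C S (-1) (uppC a b u) (X, V) βu ∧ X + S / V < b) ∨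
       ((X, V) ∉ tipE C S (-1) (bodyO a b l u) ∧ (X, V) ∈ ballE C S (b, l b) ∧
          0 < sgnf C S 1 (lowC l) (X, V) β ∧ sgnf C S (-1) (uppC a b u) (X, V) βu < 0 ∧ b < X + S / V) ∨
       ((X, V) ∉ tipE C S (-1) (bodyO a b l u) ∧ (X, V) ∉ ballE C S (b, l b) ∧
          0 < sgnf C S 1 (lowC l) (X, V) β * sgnf C S (-1) (uppC a b u) (X, V) βu)) := by
  have hρ : 0 < S / V := div_pos hS hV
  have htip : X - -1 * S / V = X + S / V := by ring
  set ρ := S / V with hρd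
  set k := C / V with hk
  rcases lt_or_gt_of_ne hA with hgt | hlt
  · -- B < b
    refine ⟨X + ρ, X + ρ, hgt.le, h2, by linarith, by linarith, le_rfl, fun t ht => ht,
      fun t ht => max_lt h2 (lt_of_le_of_lt (min_le_right _ _) ht), (min_eq_right hgt.le).symm, ?_⟩
    have e1 : sgnf C S 1 (lowC l) (X, V) (X + ρ) = l (X + ρ) - k := by
      simp only [sgnf, lowC]
      rw [arcY_tip]; rw [← hρd]; ring
    have e2 : sgnf C S (-1) (uppC a b u) (X, V) (X + ρ) = u (X + ρ) - k := by
      simp only [sgnf, uppC_of_mem u h2.le hgt.le]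
      rw [arcY_tip]; rw [← hρd]; ring
    have n1 : (X, V) ∉ ballE C S (b, l b) := by
      rintro ⟨_, h⟩
      simp only [← hρd, ← hk] at h
      nlinarith [sq_nonneg (l b - k)]
    rw [e1, e2]
    have hl := hlu _ h2 hgt
    by_cases hb : (X, V) ∈ tipE C S (-1) (bodyO a b l u)
    · left
      obtain ⟨_, _, _, h3, h4⟩ := id hb
      simp only [htip, ← hk] at h3 h4
      exact ⟨hb, n1, by linarith, by linarith, hgt⟩
    · right; right
      refine ⟨hb, n1, ?_⟩
      rcases lt_or_gt_of_ne hA1 with h3 | h3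
      · exact mul_pos (by linarith) (by linarith)
      · rcases lt_or_gt_of_ne hA2 with h4 | h4
        · refine absurd ⟨hV, ?_⟩ hb
          simp only [htip, ← hk]
          exact ⟨h2, hgt, h3, h4⟩
        · exact mul_pos_of_neg_of_neg (by linarith) (by linarith)
  · -- b < B
    refine ⟨b, b + (u b - l b), le_rfl, hab, h1, le_rfl, by linarith, fun t ht => by linarith,
      fun t _ => lt_of_le_of_lt (max_le hab.le (min_le_left _ _)) hlt, (min_eq_left hlt.le).symm, ?_⟩
    have hq : 0 < ρ ^ 2 - (b - X) ^ 2 := by nlinarith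
    set q := √(ρ ^ 2 - (b - X) ^ 2) with hqd
    have hqp : 0 < q := Real.sqrt_pos.2 hq
    have hq2 : q ^ 2 = ρ ^ 2 - (b - X) ^ 2 := Real.sq_sqrt hq.le
    have e1 : sgnf C S 1 (lowC l) (X, V) b = l b - k + q := by
      simp only [sgnf, lowC, arcY]
      rw [hqd, hρd, div_pow]; ring
    have e2 : sgnf C S (-1) (uppC a b u) (X, V) (b + (u b - l b)) = l b - k - q := by
      simp only [sgnf, arcY, uppC_right l u hlub hab.le]
      rw [hqd, hρd, div_pow]; ring
    have n1 : (X, V) ∉ tipE C S (-1) (bodyO a b l u) := by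
      rintro ⟨_, _, h, _⟩
      simp only [htip] at h
      linarith
    rw [e1, e2]
    by_cases hb : (X, V) ∈ ballE C S (b, l b)
    · right; left
      have h3 := hb.2
      simp only [← hρd, ← hk] at h3
      have h4 : |l b - k| < q := abs_lt_of_sq_lt_sq (by linarith) hqp.le
      rw [abs_lt] at h4
      exact ⟨n1, hb, by linarith, by linarith, hlt⟩
    · right; right
      have h3 : ρ ^ 2 < (b - X) ^ 2 + (l b - k) ^ 2 :=
        lt_of_le_of_ne (not_lt.1 fun h => hb ⟨hV, h⟩) hP.symm
      exact ⟨n1, hb, by nlinarith⟩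

/-- total event count -/
noncomputable def evSum (C S a b : ℝ) (l u : ℝ → ℝ) (c : ℝ × ℝ) : ENNReal :=
  (tipE C S 1 (bodyO a b l u)).indicator (fun _ => 1) c +
  (ballE C S (a, l a)).indicator (fun _ => 1) c +
  (tipE C S (-1) (bodyO a b l u)).indicator (fun _ => 1) c +
  (ballE C S (b, l b)).indicator (fun _ => 1) c

lemma pointwise (C S : ℝ) (hS : 0 < S) (a b : ℝ) (hab : a < b) (l u : ℝ → ℝ)
    (hl : Continuous l) (hu : Continuous u)
    (hlu : ∀ x, a < x → x < b → l x < u x) (hlua : l a ≤ u a) (hlub : l b ≤ u b)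
    (X V : ℝ) (hV : 0 < V)
    (hA : X - S / V ≠ a) (hA1 : C / V ≠ l (X - S / V))
    (hA2 : C / V ≠ u (X - S / V)) (hP : (a - X) ^ 2 + (l a - C / V) ^ 2 ≠ (S / V) ^ 2)
    (hB : X + S / V ≠ b) (hB1 : C / V ≠ l (X + S / V))
    (hB2 : C / V ≠ u (X + S / V)) (hQ : (b - X) ^ 2 + (l b - C / V) ^ 2 ≠ (S / V) ^ 2)
    (hD1 : ∃ p : ℝ × ℝ, (p.1 - X) ^ 2 + (p.2 - C / V) ^ 2 ≤ (S / V) ^ 2 ∧ p ∉ bodyC a b l u)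
    (hD2 : ∃ p ∈ bodyC a b l u, (S / V) ^ 2 < (p.1 - X) ^ 2 + (p.2 - C / V) ^ 2) :
    ∀ᶠ n : ℕ in Filter.atTop, evSum C S a b l u (X, V) ≤
      cnt C S 1 (lowC l) a b n (X, V) +
      cnt C S (-1) (uppC a b u) (a - (u a - l a)) (b + (u b - l b)) n (X, V) := by
  have hρ : 0 < S / V := div_pos hS hV
  have htip : X - -1 * S / V = X + S / V := by ring
  by_cases hmeet : X - S / V < b ∧ a < X + S / V
  swap
  · have h0 : evSum C S a b l u (X, V) = 0 := by
      unfold evSum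
      rw [Set.indicator_of_notMem, Set.indicator_of_notMem, Set.indicator_of_notMem,
        Set.indicator_of_notMem]
      · simp
      · rintro ⟨_, h⟩
        simp only at h
        apply hmeet
        have : |b - X| < S / V := abs_lt_of_sq_lt_sq (by nlinarith [sq_nonneg (l b - C / V)]) hρ.le
        rw [abs_lt] at this
        constructor <;> linarith
      · rintro ⟨_, h1, h2, _⟩
        simp only [htip] at h1 h2
        exact hmeet ⟨by linarith, h1⟩
      · rintro ⟨_, h⟩
        simp only at h
        apply hmeet
        have : |a - X| < S / V := abs_lt_of_sq_lt_sq (by nlinarith [sq_nonneg (l a - C / V)]) hρ.le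
        rw [abs_lt] at this
        constructor <;> linarith
      · rintro ⟨_, h1, h2, _⟩
        simp only [one_mul] at h1 h2
        exact hmeet ⟨h2, by linarith⟩
    rw [h0]
    exact Filter.Eventually.of_forall fun n => zero_le
  obtain ⟨h1, h2⟩ := hmeet
  obtain ⟨α, αu, a1, a2, a3, a4, a5, a6, a7, a8, a9⟩ :=
    leftEnd C S hS a b hab l u hlu hlua X V hV hA hA1 hA2 hP h1 h2
  obtain ⟨β, βu, b1, b2, b3, b4, b5, b6, b7, b8, b9⟩ :=
    rightEnd C S hS a b hab l u hlu hlub X V hV hB hB1 hB2 hQ h1 h2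
  have hαβ : α < β := by rw [b8]; exact lt_min a2 a3
  have hαβu : αu < βu := by linarith
  have hJl : ∀ t ∈ Set.Ioo α β, |(lowC l t).1 - (X, V).1| < S / (X, V).2 := by
    intro t ht
    have := a6 t ht.1
    have := b6 t ht.2
    simp only [lowC]; rw [abs_lt]; constructor <;> linarith
  have hJu : ∀ t ∈ Set.Ioo αu βu, |(uppC a b u t).1 - (X, V).1| < S / (X, V).2 := by
    intro t ht
    have := a7 t ht.1
    have := b7 t ht.2
    simp only [uppC]; rw [abs_lt]; constructor <;> linarith
  have hlc := continuous_lowC l hl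
  have huc := continuous_uppC a b u hu
  have one_l := cnt_one C S 1 (lowC l) hlc (X, V) hV a b α β a1 b1 hαβ hJl
  have one_u := cnt_one C S (-1) (uppC a b u) huc (X, V) hV _ _ αu βu a4 b4 hαβu hJu
  have two_l := fun x hx hx' => cnt_two C S 1 (lowC l) hlc (X, V) hV a b α x β a1 b1 hx hx' hJl
  have two_u := fun x hx hx' => cnt_two C S (-1) (uppC a b u) huc (X, V) hV _ _ αu x βu a4 b4 hx hx' hJu
  unfold evSum
  rcases a9 with ⟨p1, p2, p3, p4, p5⟩ | ⟨p1, p2, p3, p4, p5⟩ | ⟨p1, p2, p3⟩ <;>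
  rcases b9 with ⟨q1, q2, q3, q4, q5⟩ | ⟨q1, q2, q3, q4, q5⟩ | ⟨q1, q2, q3⟩ <;>
  simp only [Set.indicator_of_mem, Set.indicator_of_notMem, p1, p2, q1, q2, not_false_eq_true,
    add_zero, zero_add]
  · -- aL aR
    obtain ⟨⟨x, y⟩, hD, hK⟩ := hD1
    simp only at hD
    have hx : |x - X| ≤ S / V := abs_le_of_sq_le_sq (by nlinarith [sq_nonneg (y - C / V)]) hρ.le
    rw [abs_le] at hx
    set q := √((S / V) ^ 2 - (x - X) ^ 2) with hq
    have hy : |y - C / V| ≤ q := Real.abs_le_sqrt (by linarith)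
    rw [abs_le] at hy
    have hαx : α ≤ x := by rw [a8, max_eq_right p5.le]; linarith
    have hxβ : x ≤ β := by rw [b8, min_eq_right q5.le]; linarith
    have hor : y < l x ∨ u x < y := by
      by_contra hcon
      push Not at hcon
      exact hK ⟨by simp only; linarith, by simp only; linarith, hcon.1, hcon.2⟩
    rcases hor with h | h
    · have hpos : 0 < sgnf C S 1 (lowC l) (X, V) x := by
        simp only [sgnf, lowC, arcY]
        rw [← div_pow, ← hq]; linarith
      have hx1 : α < x := lt_of_le_of_ne hαx (by rintro rfl; linarith)
      have hx2 : x < β := lt_of_le_of_ne hxβ (by rintro rfl; linarith)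
      filter_upwards [two_l x hx1 hx2 (mul_neg_of_neg_of_pos p3 hpos) (mul_neg_of_pos_of_neg hpos q3)] with n hn
      rw [one_add_one_eq_two]
      exact hn.trans le_self_add
    · have hpos : sgnf C S (-1) (uppC a b u) (X, V) x < 0 := by
        simp only [sgnf, uppC_of_mem u (a1.trans hαx) (hxβ.trans b1), arcY]
        rw [← div_pow, ← hq]; linarith
      have hx1 : αu < x := lt_of_le_of_ne (a5.trans hαx) (by rintro rfl; linarith)
      have hx2 : x < βu := lt_of_le_of_ne (hxβ.trans b5) (by rintro rfl; linarith)
      filter_upwards [two_u x hx1 hx2 (mul_neg_of_pos_of_neg p4 hpos) (mul_neg_of_neg_of_pos hpos q4)] with n hn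
      rw [one_add_one_eq_two]
      exact hn.trans le_add_self
  · filter_upwards [one_l (mul_neg_of_neg_of_pos p3 q3), one_u (mul_neg_of_pos_of_neg p4 q4)] with n h h'
    exact add_le_add h h'
  · rcases pos_and_pos_or_neg_and_neg_of_mul_pos q3 with ⟨h, h'⟩ | ⟨h, h'⟩
    · filter_upwards [one_l (mul_neg_of_neg_of_pos p3 h)] with n hn
      exact hn.trans le_self_add
    · filter_upwards [one_u (mul_neg_of_pos_of_neg p4 h')] with n hn
      exact hn.trans le_add_self
  · filter_upwards [one_l (mul_neg_of_pos_of_neg p3 q3), one_u (mul_neg_of_neg_of_pos p4 q4)] with n h h'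
    exact add_le_add h h'
  · -- bL bR
    obtain ⟨⟨x, y⟩, ⟨k1, k2, k3, k4⟩, hD⟩ := hD2
    simp only at hD k1 k2 k3 k4
    have hx : |x - X| < S / V := by rw [abs_lt]; constructor <;> linarith
    have hx2 : (x - X) ^ 2 < (S / V) ^ 2 := by
      rw [← sq_abs (x - X)]; exact pow_lt_pow_left₀ hx (abs_nonneg _) two_ne_zero
    set q := √((S / V) ^ 2 - (x - X) ^ 2) with hq
    have hy : q < |y - C / V| := by
      rw [hq]; apply (Real.sqrt_lt' (abs_pos.2 ?_)).2
      · rw [sq_abs]; linarith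
      · intro h0; rw [h0] at hD; nlinarith
    have hα : α = a := by rw [a8, max_eq_left p5.le]
    have hβ : β = b := by rw [b8, min_eq_left q5.le]
    rcases lt_abs.1 hy with h | h
    · have hpos : 0 < sgnf C S (-1) (uppC a b u) (X, V) x := by
        simp only [sgnf, uppC_of_mem u k1 k2, arcY]
        rw [← div_pow, ← hq]; linarith
      have hx1 : αu < x := lt_of_le_of_ne (by linarith) (by rintro rfl; linarith)
      have hx2 : x < βu := lt_of_le_of_ne (by linarith) (by rintro rfl; linarith)
      filter_upwards [two_u x hx1 hx2 (mul_neg_of_neg_of_pos p4 hpos) (mul_neg_of_pos_of_neg hpos q4)] with n hn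
      rw [one_add_one_eq_two]
      exact hn.trans le_add_self
    · have hpos : sgnf C S 1 (lowC l) (X, V) x < 0 := by
        simp only [sgnf, lowC, arcY]
        rw [← div_pow, ← hq]; linarith
      have hx1 : α < x := lt_of_le_of_ne (by linarith) (by rintro rfl; linarith)
      have hx2 : x < β := lt_of_le_of_ne (by linarith) (by rintro rfl; linarith)
      filter_upwards [two_l x hx1 hx2 (mul_neg_of_pos_of_neg p3 hpos) (mul_neg_of_neg_of_pos hpos q3)] with n hn
      rw [one_add_one_eq_two]
      exact hn.trans le_self_add
  · rcases pos_and_pos_or_neg_and_neg_of_mul_pos q3 with ⟨h, h'⟩ | ⟨h, h'⟩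
    · filter_upwards [one_u (mul_neg_of_neg_of_pos p4 h')] with n hn
      exact hn.trans le_add_self
    · filter_upwards [one_l (mul_neg_of_pos_of_neg p3 h)] with n hn
      exact hn.trans le_self_add
  · rcases pos_and_pos_or_neg_and_neg_of_mul_pos p3 with ⟨h, h'⟩ | ⟨h, h'⟩
    · filter_upwards [one_l (mul_neg_of_pos_of_neg h q3)] with n hn
      exact hn.trans le_self_add
    · filter_upwards [one_u (mul_neg_of_neg_of_pos h' q4)] with n hn
      exact hn.trans le_add_self
  · rcases pos_and_pos_or_neg_and_neg_of_mul_pos p3 with ⟨h, h'⟩ | ⟨h, h'⟩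
    · filter_upwards [one_u (mul_neg_of_pos_of_neg h' q4)] with n hn
      exact hn.trans le_add_self
    · filter_upwards [one_l (mul_neg_of_neg_of_pos h q3)] with n hn
      exact hn.trans le_self_add
  · exact Filter.Eventually.of_forall fun n => zero_le


lemma null_graph (a b : ℝ) (l u : ℝ → ℝ) (hl : Continuous l) (hu : Continuous u) :
    MeasurableSet {p : ℝ × ℝ | p.1 = a ∨ p.1 = b ∨ p.2 = l p.1 ∨ p.2 = u p.1} ∧
    volume {p : ℝ × ℝ | p.1 = a ∨ p.1 = b ∨ p.2 = l p.1 ∨ p.2 = u p.1} = 0 := by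
  have hm : MeasurableSet {p : ℝ × ℝ | p.1 = a ∨ p.1 = b ∨ p.2 = l p.1 ∨ p.2 = u p.1} := by
    apply IsClosed.measurableSet
    refine IsClosed.union (isClosed_eq (by fun_prop) (by fun_prop)) ?_
    refine IsClosed.union (isClosed_eq (by fun_prop) (by fun_prop)) ?_
    exact IsClosed.union (isClosed_eq (by fun_prop) (by fun_prop)) (isClosed_eq (by fun_prop) (by fun_prop))
  refine ⟨hm, ?_⟩
  rw [Measure.volume_eq_prod, Measure.measure_prod_null hm]
  have h1 : ∀ᵐ x : ℝ, x ∉ ({a, b} : Set ℝ) :=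
    measure_eq_zero_iff_ae_notMem.1 ((Set.toFinite {a, b}).measure_zero volume)
  filter_upwards [h1] with x hx
  simp only [Set.mem_insert_iff, Set.mem_singleton_iff, not_or] at hx
  refine measure_mono_null (t := {l x, u x}) ?_ ((Set.toFinite _).measure_zero volume)
  intro y hy
  simp only [Set.mem_preimage, Set.mem_ofPred_eq, hx.1, hx.2, false_or] at hy
  exact hy

lemma null_sphere (C S x0 y0 : ℝ) :
    volume {c : ℝ × ℝ | (x0 - c.1) ^ 2 + (y0 - C / c.2) ^ 2 = (S / c.2) ^ 2} = 0 := by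
  have hm : MeasurableSet {c : ℝ × ℝ | (x0 - c.2) ^ 2 + (y0 - C / c.1) ^ 2 = (S / c.1) ^ 2} := by
    refine measurableSet_eq_fun ?_ ?_
    · refine Measurable.add ?_ ?_
      · exact (measurable_const.sub measurable_snd).pow_const 2
      · exact (measurable_const.sub (measurable_const.div measurable_fst)).pow_const 2
    · exact (measurable_const.div measurable_fst).pow_const 2
  have hsw : MeasurePreserving (Prod.swap : ℝ × ℝ → ℝ × ℝ) volume volume :=
    Measure.measurePreserving_swap
  have := hsw.measure_preimage hm.nullMeasurableSet
  have h2 : {c : ℝ × ℝ | (x0 - c.1) ^ 2 + (y0 - C / c.2) ^ 2 = (S / c.2) ^ 2} =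
    Prod.swap ⁻¹' {c : ℝ × ℝ | (x0 - c.2) ^ 2 + (y0 - C / c.1) ^ 2 = (S / c.1) ^ 2} := rfl
  rw [h2, this, Measure.volume_eq_prod, Measure.measure_prod_null hm]
  refine Filter.Eventually.of_forall fun V => ?_
  refine measure_mono_null (t := {x0 + √((S / V)^2 - (y0 - C / V) ^ 2), x0 - √((S / V)^2 - (y0 - C / V) ^ 2)}) ?_
    ((Set.toFinite _).measure_zero volume)
  intro X hX
  simp only [Set.mem_preimage, Set.mem_ofPred_eq] at hX
  have h3 : |x0 - X| = √((S / V)^2 - (y0 - C / V) ^ 2) := by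
    rw [← Real.sqrt_sq_eq_abs]; congr 1; linarith
  rcases abs_choice (x0 - X) with h | h
  · right; simp only [Set.mem_singleton_iff]; linarith
  · left; linarith

lemma mesh_small {E : Type*} [MetricSpace E] (γ : ℝ → E) (t0 t1 : ℝ) (h : t0 ≤ t1) (hc : ContinuousOn γ (Set.Icc t0 t1))
    (ε : ℝ) (hε : 0 < ε) :
    ∀ᶠ n : ℕ in Filter.atTop, ∀ j < n, dist (γ (grid t0 t1 n j)) (γ (grid t0 t1 n (j+1))) ≤ ε := by
  have huc := isCompact_Icc.uniformContinuousOn_of_continuous hc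
  obtain ⟨δ, hδ, H⟩ := Metric.uniformContinuousOn_iff.1 huc ε hε
  have ht : Filter.Tendsto (fun n : ℕ => (t1 - t0) / (n:ℝ)) Filter.atTop (nhds 0) :=
    tendsto_const_div_atTop_nhds_zero_nat _
  filter_upwards [ht.eventually (gt_mem_nhds hδ)] with n hn j hj
  refine (H _ (grid_mem t0 t1 h n j hj.le) _ (grid_mem t0 t1 h n (j+1) hj) ?_).le
  rw [Real.dist_eq]
  unfold grid
  push_cast
  have : (0:ℝ) ≤ (t1 - t0) / n := div_nonneg (sub_nonneg.2 h) (Nat.cast_nonneg n)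
  rw [abs_sub_comm, show t0 + ((j:ℝ) + 1) * ((t1 - t0) / n) - (t0 + j * ((t1 - t0) / n)) = (t1 - t0) / n by ring,
    abs_of_nonneg this]
  exact hn

lemma measurable_cnt (C S e : ℝ) (γ : ℝ → ℝ × ℝ) (t0 t1 : ℝ) (n : ℕ) :
    Measurable (cnt C S e γ t0 t1 n) := by
  unfold cnt
  exact Finset.measurable_sum _ fun j _ => measurable_const.indicator (measurableSet_linkE _ _ _ _ _)

lemma lintegral_cnt (r e : ℝ) (he : e ^ 2 = 1) (hr : 0 < r) (γ : ℝ → ℝ × ℝ) (t0 t1 : ℝ) (h : t0 ≤ t1)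
    (hγ : ∀ t ∈ Set.Icc t0 t1, 0 < (γ t).2) (n : ℕ) (ε : ℝ)
    (hn : ∀ j < n, dist (hp (γ (grid t0 t1 n j))) (hp (γ (grid t0 t1 n (j+1)))) ≤ ε) :
    ∫⁻ c, cnt (cosh r) (sinh r) e γ t0 t1 n c ≤ ENNReal.ofReal (2 * sinh r * exp ε) *
      ∑ j ∈ Finset.range n, ENNReal.ofReal (dist (hp (γ (grid t0 t1 n j))) (hp (γ (grid t0 t1 n (j+1))))) := by
  unfold cnt
  rw [lintegral_finsetSum _ (fun j _ => measurable_const.indicator (measurableSet_linkE _ _ _ _ _)),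
    Finset.mul_sum]
  apply Finset.sum_le_sum
  intro j hj
  have hj' := Finset.mem_range.1 hj
  have hS : 0 < sinh r := Real.sinh_pos_iff.2 hr
  rw [lintegral_indicator_const (measurableSet_linkE _ _ _ _ _), one_mul]
  refine (vol_linkE r e he hr _ _ (hγ _ (grid_mem t0 t1 h n j hj'.le))
    (hγ _ (grid_mem t0 t1 h n (j+1) hj'))).trans ?_
  rw [← ENNReal.ofReal_mul (by positivity)]
  apply ENNReal.ofReal_le_ofReal
  have hd := hn j hj'
  have h0 : 0 ≤ dist (hp (γ (grid t0 t1 n j))) (hp (γ (grid t0 t1 n (j+1)))) := dist_nonneg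
  generalize dist (hp (γ (grid t0 t1 n j))) (hp (γ (grid t0 t1 n (j+1)))) = d at *
  rw [mul_assoc (2 * sinh r)]
  apply mul_le_mul_of_nonneg_left _ (by positivity)
  -- exp d - 1 ≤ exp ε * d
  have h1 : 1 - d ≤ exp (-d) := by have := Real.add_one_le_exp (-d); linarith
  have h2 : exp d * exp (-d) = 1 := by rw [← Real.exp_add]; simp
  have h3 : exp d ≤ exp ε := Real.exp_le_exp.2 hd
  nlinarith [Real.exp_pos d]

lemma main_coord (r : ℝ) (hr : 0 < r) (a b : ℝ) (hab : a < b) (l u : ℝ → ℝ)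
    (hl : Continuous l) (hu : Continuous u) (hlpos : ∀ x, 0 < l x)
    (hlu : ∀ x, a < x → x < b → l x < u x) (hlua : l a ≤ u a) (hlub : l b ≤ u b)
    (L : ENNReal) (hL : L ≠ ⊤)
    (hlen : ∀ n : ℕ, ∑ j ∈ Finset.range n, ENNReal.ofReal (dist (hp (lowC l (grid a b n j)))
        (hp (lowC l (grid a b n (j+1))))) +
      ∑ j ∈ Finset.range n, ENNReal.ofReal
        (dist (hp (uppC a b u (grid (a - (u a - l a)) (b + (u b - l b)) n j)))
        (hp (uppC a b u (grid (a - (u a - l a)) (b + (u b - l b)) n (j+1))))) ≤ L)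
    (hD : ∀ᵐ c : ℝ × ℝ, 0 < c.2 →
      (∃ p : ℝ × ℝ, (p.1 - c.1) ^ 2 + (p.2 - cosh r / c.2) ^ 2 ≤ (sinh r / c.2) ^ 2 ∧ p ∉ bodyC a b l u) ∧
      (∃ p ∈ bodyC a b l u, (sinh r / c.2) ^ 2 < (p.1 - c.1) ^ 2 + (p.2 - cosh r / c.2) ^ 2)) :
    2 * (ENNReal.ofReal (cosh r) * ∫⁻ p in bodyO a b l u, ENNReal.ofReal ((p.2 ^ 2)⁻¹)) +
      2 * ENNReal.ofReal (2 * π * (cosh r - 1)) ≤ ENNReal.ofReal (2 * sinh r) * L := by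
  have hS : 0 < sinh r := Real.sinh_pos_iff.2 hr
  have hC : 0 < cosh r := Real.cosh_pos r
  set C := cosh r with hCd
  set S := sinh r with hSd
  set tL := a - (u a - l a) with htL
  set tR := b + (u b - l b) with htR
  have htLR : tL ≤ tR := by linarith
  set N : ℕ → ℝ × ℝ → ENNReal := fun n c => cnt C S 1 (lowC l) a b n c +
      cnt C S (-1) (uppC a b u) tL tR n c with hN
  have hbodym : MeasurableSet (bodyO a b l u) := by
    have o1 : IsOpen {p : ℝ × ℝ | a < p.1} := isOpen_lt continuous_const continuous_fst
    have o2 : IsOpen {p : ℝ × ℝ | p.1 < b} := isOpen_lt continuous_fst continuous_const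
    have o3 : IsOpen {p : ℝ × ℝ | l p.1 < p.2} := isOpen_lt (hl.comp continuous_fst) continuous_snd
    have o4 : IsOpen {p : ℝ × ℝ | p.2 < u p.1} := isOpen_lt continuous_snd (hu.comp continuous_fst)
    exact (o1.inter (o2.inter (o3.inter o4))).measurableSet
  -- pointwise a.e.
  obtain ⟨gm, g0⟩ := null_graph a b l u hl hu
  have n1 := measure_eq_zero_iff_ae_notMem.1 (vol_tipE_null C S 1 hC _ gm g0)
  have n2 := measure_eq_zero_iff_ae_notMem.1 (vol_tipE_null C S (-1) hC _ gm g0)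
  have n3 := measure_eq_zero_iff_ae_notMem.1 (null_sphere C S a (l a))
  have n4 := measure_eq_zero_iff_ae_notMem.1 (null_sphere C S b (l b))
  have hpt : ∀ᵐ c : ℝ × ℝ, evSum C S a b l u c ≤ Filter.liminf (fun n => N n c) Filter.atTop := by
    filter_upwards [n1, n2, n3, n4, hD] with c m1 m2 m3 m4 m5
    obtain ⟨X, V⟩ := c
    rcases le_or_gt V 0 with hV | hV
    · have h0 : evSum C S a b l u (X, V) = 0 := by
        unfold evSum
        rw [Set.indicator_of_notMem, Set.indicator_of_notMem, Set.indicator_of_notMem,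
          Set.indicator_of_notMem]
        · simp
        all_goals rintro ⟨h, _⟩; simp only at h; linarith
      rw [h0]; exact zero_le
    · apply Filter.le_liminf_of_le
      · isBoundedDefault
      · have htip : X - -1 * S / V = X + S / V := by ring
        have m1' : ¬ (X - S / V = a ∨ X - S / V = b ∨ C / V = l (X - S / V) ∨ C / V = u (X - S / V)) := by
          intro h; apply m1; refine ⟨hV, ?_⟩; simpa [one_mul] using h
        have m2' : ¬ (X + S / V = a ∨ X + S / V = b ∨ C / V = l (X + S / V) ∨ C / V = u (X + S / V)) := by
          intro h; apply m2; refine ⟨hV, ?_⟩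
          simp only [htip, Set.mem_ofPred_eq]; exact h
        push Not at m1' m2'
        obtain ⟨d1, d2⟩ := m5 hV
        exact pointwise C S hS a b hab l u hl hu hlu hlua hlub X V hV m1'.1 m1'.2.2.1 m1'.2.2.2
          m3 m2'.2.1 m2'.2.2.1 m2'.2.2.2 m4 d1 d2
  have hpos_l : ∀ t ∈ Set.Icc a b, 0 < (lowC l t).2 := fun t _ => hlpos t
  have hpos_u : ∀ t ∈ Set.Icc tL tR, 0 < (uppC a b u t).2 := by
    intro t ht
    rcases le_total t a with h | h
    · simp only [uppC, clampf_of_le h hab.le]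
      rw [abs_of_nonpos (by linarith)]
      have := hlpos a; have := ht.1; linarith
    · rcases le_total t b with h' | h'
      · rw [uppC_of_mem u h h']
        have h3 := hlpos t
        rcases h.eq_or_lt with rfl | h4
        · simp only; linarith
        · rcases h'.eq_or_lt with rfl | h5
          · simp only; linarith
          · have := hlu t h4 h5; simp only; linarith
      · simp only [uppC, clampf_of_ge h' hab.le]
        rw [abs_of_nonneg (by linarith)]
        have := hlpos b; have := ht.2; linarith
  have hcl : ContinuousOn (fun t => hp (lowC l t)) (Set.Icc a b) :=
    continuousOn_hp.comp (continuous_lowC l hl).continuousOn hpos_l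
  have hcu : ContinuousOn (fun t => hp (uppC a b u t)) (Set.Icc tL tR) :=
    continuousOn_hp.comp (continuous_uppC a b u hu).continuousOn hpos_u
  have hup : ∀ ε : ℝ, 0 < ε → ∫⁻ c, evSum C S a b l u c ≤ ENNReal.ofReal (2 * S * exp ε) * L := by
    intro ε hε
    calc ∫⁻ c, evSum C S a b l u c ≤ ∫⁻ c, Filter.liminf (fun n => N n c) Filter.atTop :=
          lintegral_mono_ae hpt
      _ ≤ Filter.liminf (fun n => ∫⁻ c, N n c) Filter.atTop :=
          lintegral_liminf_le fun n => (measurable_cnt _ _ _ _ _ _ _).add (measurable_cnt _ _ _ _ _ _ _)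
      _ ≤ ENNReal.ofReal (2 * S * exp ε) * L := by
          apply Filter.liminf_le_of_frequently_le'
          apply Filter.Eventually.frequently
          filter_upwards [mesh_small _ a b hab.le hcl ε hε, mesh_small _ tL tR htLR hcu ε hε] with n h1 h2
          rw [hN, lintegral_add_left (measurable_cnt _ _ _ _ _ _ _)]
          refine (add_le_add (lintegral_cnt r 1 (by norm_num) hr _ a b hab.le hpos_l n ε h1)
            (lintegral_cnt r (-1) (by norm_num) hr _ tL tR htLR hpos_u n ε h2)).trans ?_
          rw [← mul_add]
          exact mul_le_mul_right (hlen n) _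
  have hev : ∫⁻ c, evSum C S a b l u c = 2 * (ENNReal.ofReal C * ∫⁻ p in bodyO a b l u, ENNReal.ofReal ((p.2 ^ 2)⁻¹)) +
      2 * ENNReal.ofReal (2 * π * (C - 1)) := by
    have hbp : ∀ p ∈ bodyO a b l u, 0 < p.2 := fun p h => (hlpos p.1).trans h.2.2.1
    have t1 := measurableSet_tipE C S 1 _ hbodym
    have t2 := measurableSet_tipE C S (-1) _ hbodym
    have t3 := measurableSet_ballE C S (a, l a)
    have t4 := measurableSet_ballE C S (b, l b)
    have i1 : Measurable (Set.indicator (tipE C S 1 (bodyO a b l u)) (fun _ => (1:ENNReal))) :=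
      measurable_const.indicator t1
    have i2 : Measurable (Set.indicator (tipE C S (-1) (bodyO a b l u)) (fun _ => (1:ENNReal))) :=
      measurable_const.indicator t2
    have i3 : Measurable (Set.indicator (ballE C S (a, l a)) (fun _ => (1:ENNReal))) :=
      measurable_const.indicator t3
    have i4 : Measurable (Set.indicator (ballE C S (b, l b)) (fun _ => (1:ENNReal))) :=
      measurable_const.indicator t4
    unfold evSum
    rw [lintegral_add_right _ i4, lintegral_add_right _ i2, lintegral_add_right _ i3,
      lintegral_indicator_const t1, lintegral_indicator_const t2, lintegral_indicator_const t3,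
      lintegral_indicator_const t4, vol_tipE C S 1 hC _ hbodym hbp, vol_tipE C S (-1) hC _ hbodym hbp,
      vol_ballE r hr _ (hlpos a), vol_ballE r hr _ (hlpos b)]
    ring
  rw [← hev]
  have hlim : Filter.Tendsto (fun ε : ℝ => ENNReal.ofReal (2 * S * exp ε) * L) (nhdsWithin 0 (Set.Ioi 0))
      (nhds (ENNReal.ofReal (2 * S) * L)) := by
    refine ENNReal.Tendsto.mul_const ?_ (Or.inr hL)
    have h1 : Continuous fun ε : ℝ => ENNReal.ofReal (2 * S * exp ε) :=
      ENNReal.continuous_ofReal.comp (by fun_prop)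
    have h2 := h1.tendsto 0
    simp only [Real.exp_zero, mul_one] at h2
    exact h2.mono_left nhdsWithin_le_nhds
  refine ge_of_tendsto hlim ?_
  filter_upwards [self_mem_nhdsWithin] with ε hε
  exact hup ε hε


lemma cosh_dist_hp' (z w : ℍ) :
    cosh (dist z w) = (z.im ^ 2 + w.im ^ 2 + (z.re - w.re) ^ 2) / (2 * z.im * w.im) := by
  rw [UpperHalfPlane.cosh_dist, Complex.dist_eq, Complex.sq_norm, Complex.normSq_apply]
  have h1 := z.im_pos
  have h2 := w.im_pos
  simp only [Complex.sub_re, Complex.sub_im, UpperHalfPlane.coe_re, UpperHalfPlane.coe_im]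
  field_simp
  ring

lemma sinh_dist_of (z w : ℍ) (s : ℝ) (hs : 0 ≤ s)
    (h : (z.im ^ 2 + w.im ^ 2 + (z.re - w.re) ^ 2) ^ 2 - s ^ 2 = (2 * z.im * w.im) ^ 2) :
    sinh (dist z w) = s / (2 * z.im * w.im) := by
  have h1 := z.im_pos
  have h2 := w.im_pos
  have h3 := Real.cosh_sq (dist z w)
  rw [cosh_dist_hp'] at h3
  have h4 : 0 ≤ sinh (dist z w) := Real.sinh_nonneg_iff.2 dist_nonneg
  have h5 : 0 ≤ s / (2 * z.im * w.im) := by positivity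
  have h6 : sinh (dist z w) ^ 2 = (s / (2 * z.im * w.im)) ^ 2 := by
    have : sinh (dist z w) ^ 2 = ((z.im ^ 2 + w.im ^ 2 + (z.re - w.re) ^ 2) / (2 * z.im * w.im)) ^ 2 - 1 := by
      linarith
    rw [this, div_pow, div_pow, ← h]
    have : (2 * z.im * w.im) ^ 2 ≠ 0 := by positivity
    rw [← h] at this
    field_simp
    ring
  exact (pow_left_inj₀ h4 h5 two_ne_zero).1 h6

lemma geod_pt (z1 z2 z : ℍ) (θ : ℝ) (h0 : 0 ≤ θ) (h1 : θ ≤ 1)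
    (hx : z.re = (1 - θ) * z1.re + θ * z2.re)
    (hy : z.re ^ 2 + z.im ^ 2 = (1 - θ) * (z1.re ^ 2 + z1.im ^ 2) + θ * (z2.re ^ 2 + z2.im ^ 2)) :
    dist z1 z + dist z z2 = dist z1 z2 := by
  have p1 := z1.im_pos
  have p2 := z2.im_pos
  have p := z.im_pos
  have hy' : z.im ^ 2 = (1 - θ) * z1.im ^ 2 + θ * z2.im ^ 2 + θ * (1 - θ) * (z2.re - z1.re) ^ 2 := by
    rw [hx] at hy
    linear_combination hy
  set D := (z2.im ^ 2 - z1.im ^ 2 + (z2.re - z1.re) ^ 2) ^ 2 + 4 * (z2.re - z1.re) ^ 2 * z1.im ^ 2 with hD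
  have hD0 : 0 ≤ D := by positivity
  have hsq : √D ^ 2 = D := Real.sq_sqrt hD0
  have s1 := sinh_dist_of z1 z (θ * √D) (by positivity) (by
    rw [mul_pow, hsq, mul_pow _ z.im, hy', hx, hD]; ring)
  have s2 := sinh_dist_of z z2 ((1 - θ) * √D) (mul_nonneg (by linarith) (Real.sqrt_nonneg _)) (by
    rw [mul_pow, hsq, mul_pow _ z2.im, mul_pow _ z.im, hy', hx, hD]; ring)
  have hc : cosh (dist z1 z + dist z z2) = cosh (dist z1 z2) := by
    rw [Real.cosh_add, s1, s2, cosh_dist_hp', cosh_dist_hp', cosh_dist_hp' z1 z2]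
    have : θ * √D / (2 * z1.im * z.im) * ((1 - θ) * √D / (2 * z.im * z2.im)) =
        θ * (1 - θ) * D / ((2 * z1.im * z.im) * (2 * z.im * z2.im)) := by
      rw [div_mul_div_comm]; congr 1; linear_combination θ * (1 - θ) * hsq
    rw [this, div_mul_div_comm, ← add_div, div_eq_div_iff (by positivity) (by positivity)]
    have e : (2 * z1.im * z.im * (2 * z.im * z2.im)) = 4 * z1.im * z2.im * z.im ^ 2 := by ring
    rw [e, hy', hx, hD]; ring
  have := Real.cosh_strictMonoOn.injOn (x₁ := dist z1 z + dist z z2) (x₂ := dist z1 z2)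
    (by simp only [Set.mem_Ici]; positivity) (by simp only [Set.mem_Ici]; positivity) hc
  exact this

/-- paraboloid coordinates -/
def parQ (K : Set ℍ) : Set (ℝ × ℝ) := (fun z : ℍ => (z.re, z.re ^ 2 + z.im ^ 2)) '' K

lemma parQ_compact (K : Set ℍ) (hK : IsCompact K) : IsCompact (parQ K) := by
  apply hK.image
  have h1 := UpperHalfPlane.continuous_re
  have h2 := UpperHalfPlane.continuous_im
  fun_prop

lemma parQ_convex (K : Set ℍ) (hK : HypConvex K) : Convex ℝ (parQ K) := by
  rintro _ ⟨z1, k1, rfl⟩ _ ⟨z2, k2, rfl⟩ s t hs ht hst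
  have hs' : s = 1 - t := by linarith
  subst hs'
  have p1 := z1.im_pos
  have p2 := z2.im_pos
  set x := (1 - t) * z1.re + t * z2.re with hx
  set W := (1 - t) * (z1.re ^ 2 + z1.im ^ 2) + t * (z2.re ^ 2 + z2.im ^ 2) with hW
  have hpos : 0 < W - x ^ 2 := by
    have e : W - x ^ 2 = (1 - t) * z1.im ^ 2 + t * z2.im ^ 2 + t * (1 - t) * (z2.re - z1.re) ^ 2 := by
      rw [hW, hx]; ring
    rw [e]
    have : 0 < (1 - t) * z1.im ^ 2 + t * z2.im ^ 2 := by
      rcases hs.eq_or_lt with h | h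
      · rw [← h]; have : t = 1 := by linarith
        rw [this]; positivity
      · positivity
    have h3 : 0 ≤ t * (1 - t) * (z2.re - z1.re) ^ 2 := by positivity
    linarith
  have hq : 0 < ((x, √(W - x ^ 2)) : ℝ × ℝ).2 := Real.sqrt_pos.2 hpos
  have hre : (hp (x, √(W - x ^ 2))).re = x := hp_re hq
  have him : (hp (x, √(W - x ^ 2))).im = √(W - x ^ 2) := hp_im hq
  have hsq : (hp (x, √(W - x ^ 2))).re ^ 2 + (hp (x, √(W - x ^ 2))).im ^ 2 = W := by
    rw [hre, him, Real.sq_sqrt hpos.le]; ring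
  refine ⟨hp (x, √(W - x ^ 2)), hK z1 k1 z2 k2 _ (geod_pt z1 z2 _ t ht (by linarith) hre hsq), ?_⟩
  simp only
  rw [hsq, hre]
  simp [hx, hW]

lemma mem_parQ (K : Set ℍ) (p : ℝ × ℝ) (h : 0 < p.2) : hp p ∈ K ↔ (p.1, p.1 ^ 2 + p.2 ^ 2) ∈ parQ K := by
  constructor
  · intro hk
    exact ⟨hp p, hk, by simp [hp_re h, hp_im h]⟩
  · rintro ⟨z, hz, he⟩
    simp only [Prod.mk.injEq] at he
    obtain ⟨e1, e2⟩ := he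
    have : z.im = p.2 := by
      rw [e1] at e2
      have e3 : z.im ^ 2 = p.2 ^ 2 := by linarith
      exact (pow_left_inj₀ z.im_pos.le h.le two_ne_zero).1 e3
    have : hp p = z := by
      rw [← hp_self z, e1, this]
    rwa [this]

lemma upper_fun (Q : Set (ℝ × ℝ)) (hQ : IsCompact Q) (hc : Convex ℝ Q) (a b : ℝ)
    (hpr : Prod.fst '' Q = Set.Icc a b) :
    ∃ U : ℝ → ℝ, ContinuousOn U (Set.Icc a b) ∧
      ∀ x ∈ Set.Icc a b, (x, U x) ∈ Q ∧ ∀ W, (x, W) ∈ Q → W ≤ U x := by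
  have hex : ∀ x, ∃ w, x ∈ Set.Icc a b → (x, w) ∈ Q ∧ ∀ W, (x, W) ∈ Q → W ≤ w := by
    intro x
    by_cases hx : x ∈ Set.Icc a b
    · have hne : (Q ∩ {p | p.1 = x}).Nonempty := by
        rw [← hpr] at hx
        obtain ⟨p, hp1, hp2⟩ := hx
        exact ⟨p, hp1, hp2⟩
      have hcomp : IsCompact (Q ∩ {p | p.1 = x}) :=
        hQ.inter_right (isClosed_eq continuous_fst continuous_const)
      obtain ⟨p, ⟨pq, px⟩, hmax⟩ := hcomp.exists_isMaxOn hne continuous_snd.continuousOn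
      refine ⟨p.2, fun _ => ⟨?_, fun W hW => hmax ⟨hW, rfl⟩⟩⟩
      have px' : p.1 = x := px
      rw [← px']; exact pq
    · exact ⟨0, fun h => absurd h hx⟩
  choose U hU using hex
  refine ⟨U, ?_, hU⟩
  have conc : ∀ x ∈ Set.Icc a b, ∀ y ∈ Set.Icc a b, ∀ t, 0 ≤ t → t ≤ 1 →
      (1 - t) * U x + t * U y ≤ U ((1 - t) * x + t * y) := by
    intro x hx y hy t h0 h1
    have hm := hc (hU x hx).1 (hU y hy).1 (by linarith : 0 ≤ 1 - t) h0 (by ring)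
    have hm' : ((1 - t) * x + t * y, (1 - t) * U x + t * U y) ∈ Q := by simpa using hm
    have hin : (1 - t) * x + t * y ∈ Set.Icc a b := by
      rw [← hpr]; exact ⟨_, hm', rfl⟩
    exact (hU _ hin).2 _ hm'
  -- upper semicontinuity
  have usc : UpperSemicontinuousOn U (Set.Icc a b) := by
    intro x0 hx0 y hy
    by_contra hcon
    have hfr : ∃ᶠ x in nhdsWithin x0 (Set.Icc a b), y ≤ U x := by
      simpa [Filter.not_eventually] using hcon
    have hfr' := hfr.and_eventually self_mem_nhdsWithin
    obtain ⟨s, hs1, hs2⟩ := Filter.exists_seq_forall_of_frequently hfr'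
    obtain ⟨q, hq, φ, hφ, hlim⟩ := hQ.tendsto_subseq (x := fun n => (s n, U (s n)))
      (fun n => (hU _ (hs2 n).2).1)
    have l1 : Filter.Tendsto (fun n => s (φ n)) Filter.atTop (nhds q.1) :=
      (continuous_fst.tendsto q).comp hlim
    have l2 : Filter.Tendsto (fun n => U (s (φ n))) Filter.atTop (nhds q.2) :=
      (continuous_snd.tendsto q).comp hlim
    have l3 : Filter.Tendsto (fun n => s (φ n)) Filter.atTop (nhds x0) :=
      (hs1.mono_right nhdsWithin_le_nhds).comp hφ.tendsto_atTop
    have e : q.1 = x0 := tendsto_nhds_unique l1 l3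
    have hle : y ≤ q.2 := ge_of_tendsto' l2 (fun n => (hs2 _).1)
    have : q.2 ≤ U x0 := (hU x0 hx0).2 _ (by rw [← e]; exact hq)
    linarith
  have lsc : LowerSemicontinuousOn U (Set.Icc a b) := by
    intro x0 hx0 y hy
    -- interpolation towards endpoint e
    have key : ∀ e ∈ Set.Icc a b, e ≠ x0 → ∀ᶠ x in nhds x0, ∀ t, t = (x - x0) / (e - x0) → 0 ≤ t → y < U x := by
      intro e he hne
      have hne' : e - x0 ≠ 0 := sub_ne_zero.2 hne
      have hcont : Continuous fun x => (1 - (x - x0) / (e - x0)) * U x0 + (x - x0) / (e - x0) * U e := by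
        fun_prop
      have h1 : ∀ᶠ x in nhds x0, y < (1 - (x - x0) / (e - x0)) * U x0 + (x - x0) / (e - x0) * U e := by
        apply (hcont.tendsto x0).eventually_const_lt
        simpa using hy
      have hcont2 : Continuous fun x => (x - x0) / (e - x0) := by fun_prop
      have h2 : ∀ᶠ x in nhds x0, (x - x0) / (e - x0) < 1 := by
        apply (hcont2.tendsto x0).eventually_lt_const
        simp
      filter_upwards [h1, h2] with x g1 g2 t ht h0
      subst ht
      refine g1.trans_le ((conc x0 hx0 e he _ h0 g2.le).trans (le_of_eq ?_))
      congr 1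
      field_simp
      ring
    have ha : a ∈ Set.Icc a b := ⟨le_rfl, hx0.1.trans hx0.2⟩
    have hb : b ∈ Set.Icc a b := ⟨hx0.1.trans hx0.2, le_rfl⟩
    have ka : ∀ᶠ x in nhdsWithin x0 (Set.Icc a b), x < x0 → y < U x := by
      by_cases h : a = x0
      · filter_upwards [self_mem_nhdsWithin] with x hx hlt
        have := hx.1; linarith
      · filter_upwards [nhdsWithin_le_nhds (key a ha h)] with x hx hlt
        exact hx _ rfl (div_nonneg_of_nonpos (by linarith) (by have := hx0.1; linarith))
    have kb : ∀ᶠ x in nhdsWithin x0 (Set.Icc a b), x0 < x → y < U x := by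
      by_cases h : b = x0
      · filter_upwards [self_mem_nhdsWithin] with x hx hlt
        have := hx.2; linarith
      · filter_upwards [nhdsWithin_le_nhds (key b hb h)] with x hx hlt
        exact hx _ rfl (div_nonneg (by linarith) (by have := hx0.2; linarith))
    filter_upwards [ka, kb] with x h1 h2
    rcases lt_trichotomy x x0 with h | h | h
    · exact h1 h
    · rw [h]; exact hy
    · exact h2 h
  exact continuousOn_iff_lower_upperSemicontinuousOn.2 ⟨lsc, usc⟩

lemma lower_fun (Q : Set (ℝ × ℝ)) (hQ : IsCompact Q) (hc : Convex ℝ Q) (a b : ℝ)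
    (hpr : Prod.fst '' Q = Set.Icc a b) :
    ∃ U : ℝ → ℝ, ContinuousOn U (Set.Icc a b) ∧
      ∀ x ∈ Set.Icc a b, (x, U x) ∈ Q ∧ ∀ W, (x, W) ∈ Q → U x ≤ W := by
  set f : (ℝ × ℝ) →ₗ[ℝ] (ℝ × ℝ) := LinearMap.prodMap LinearMap.id (-LinearMap.id) with hf
  have hfe : ∀ p, f p = (p.1, -p.2) := fun p => by simp [hf]
  have hfc : Continuous f := by
    have : (f : ℝ × ℝ → ℝ × ℝ) = fun p => (p.1, -p.2) := funext hfe
    rw [this]; fun_prop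
  have hpr' : Prod.fst '' (f '' Q) = Set.Icc a b := by
    rw [← hpr, Set.image_image]; simp [hfe]
  obtain ⟨U, hU, h⟩ := upper_fun (f '' Q) (hQ.image hfc) (hc.linear_image f) a b hpr'
  refine ⟨fun x => - U x, hU.neg, fun x hx => ⟨?_, fun W hW => ?_⟩⟩
  · obtain ⟨q, hq, he⟩ := (h x hx).1
    rw [hfe] at he
    simp only [Prod.mk.injEq] at he
    have : q = (x, - U x) := by ext <;> simp <;> linarith
    rwa [← this]
  · have := (h x hx).2 (-W) ⟨(x, W), hW, by rw [hfe]⟩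
    linarith


lemma clampf_mem (a b t : ℝ) (h : a ≤ b) : clampf a b t ∈ Set.Icc a b := by
  simp [clampf, h]

lemma continuous_clampf (a b : ℝ) : Continuous (clampf a b) := by
  unfold clampf; fun_prop

lemma structK (K : Set ℍ) (hK : IsCompact K) (hc : HypConvex K) (hi : (interior K).Nonempty) :
    ∃ (a b : ℝ) (l u : ℝ → ℝ), a < b ∧ Continuous l ∧ Continuous u ∧ (∀ x, 0 < l x) ∧
      (∀ x, a < x → x < b → l x < u x) ∧ l a ≤ u a ∧ l b ≤ u b ∧
      ∀ p : ℝ × ℝ, 0 < p.2 → (hp p ∈ K ↔ p ∈ bodyC a b l u) := by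
  obtain ⟨z0, hz0⟩ := hi
  have Qc := parQ_compact K hK
  have Qv := parQ_convex K hc
  have hpc : IsCompact (Prod.fst '' parQ K) := Qc.image continuous_fst
  have hpv : Convex ℝ (Prod.fst '' parQ K) := Qv.linear_image (LinearMap.fst ℝ ℝ ℝ)
  have hz0K := interior_subset hz0
  have hne : (Prod.fst '' parQ K).Nonempty := ⟨_, _, ⟨z0, hz0K, rfl⟩, rfl⟩
  obtain ⟨a, b, hab0, hpr⟩ : ∃ a b, a ≤ b ∧ Prod.fst '' parQ K = Set.Icc a b := by
    have := eq_Icc_of_connected_compact ⟨hne, hpv.isPreconnected⟩ hpc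
    refine ⟨_, _, ?_, this⟩
    by_contra h
    rw [this, Set.Icc_eq_empty h] at hne
    exact Set.not_nonempty_empty hne
  obtain ⟨U, Uc, hU⟩ := upper_fun _ Qc Qv a b hpr
  obtain ⟨W, Wc, hW⟩ := lower_fun _ Qc Qv a b hpr
  -- points near z0
  have hnear : ∀ᶠ q : ℝ × ℝ in nhds (z0.re, z0.im), hp q ∈ K := by
    have hpos : {p : ℝ × ℝ | 0 < p.2} ∈ nhds (z0.re, z0.im) :=
      (isOpen_lt continuous_const continuous_snd).mem_nhds z0.im_pos
    have hct : ContinuousAt hp (z0.re, z0.im) := continuousOn_hp.continuousAt hpos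
    apply hct.eventually_mem
    rw [hp_self]
    exact mem_interior_iff_mem_nhds.1 hz0
  have hmemQ : ∀ q ∈ parQ K, q.1 ∈ Set.Icc a b := fun q hq => by rw [← hpr]; exact ⟨q, hq, rfl⟩
  obtain ⟨x1, hx1, hx1a⟩ : ∃ x, z0.re < x ∧ x ∈ Set.Icc a b := by
    have hct : ContinuousAt (fun x : ℝ => (x, z0.im)) z0.re := by fun_prop
    have h1 : ∀ᶠ x in nhdsWithin z0.re (Set.Ioi z0.re), hp (x, z0.im) ∈ K :=
      nhdsWithin_le_nhds (hct.eventually hnear)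
    obtain ⟨x, hx, hx'⟩ := (h1.and self_mem_nhdsWithin).exists
    exact ⟨x, hx', hmemQ _ ((mem_parQ K (x, z0.im) z0.im_pos).1 hx)⟩
  obtain ⟨x2, hx2, hx2a⟩ : ∃ x, x < z0.re ∧ x ∈ Set.Icc a b := by
    have hct : ContinuousAt (fun x : ℝ => (x, z0.im)) z0.re := by fun_prop
    have h1 : ∀ᶠ x in nhdsWithin z0.re (Set.Iio z0.re), hp (x, z0.im) ∈ K :=
      nhdsWithin_le_nhds (hct.eventually hnear)
    obtain ⟨x, hx, hx'⟩ := (h1.and self_mem_nhdsWithin).exists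
    exact ⟨x, hx', hmemQ _ ((mem_parQ K (x, z0.im) z0.im_pos).1 hx)⟩
  have hx0 : z0.re ∈ Set.Icc a b := hmemQ _ ⟨z0, hz0K, rfl⟩
  have hWU0 : W z0.re < U z0.re := by
    have hct : ContinuousAt (fun y : ℝ => (z0.re, y)) z0.im := by fun_prop
    have h1 : ∀ᶠ y in nhdsWithin z0.im (Set.Ioi z0.im), hp (z0.re, y) ∈ K :=
      nhdsWithin_le_nhds (hct.eventually hnear)
    obtain ⟨y, hy, hy'⟩ := (h1.and self_mem_nhdsWithin).exists
    have hy2 : z0.im < y := hy'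
    have p0 := z0.im_pos
    have m1 := (mem_parQ K (z0.re, y) (p0.trans hy2)).1 hy
    have m2 : (z0.re, z0.re ^ 2 + z0.im ^ 2) ∈ parQ K := ⟨z0, hz0K, rfl⟩
    have := (hU _ hx0).2 _ m1
    have := (hW _ hx0).2 _ m2
    simp only at *
    nlinarith
  have hab : a < b := by have := hx1a.2; have := hx2a.1; linarith
  have hWU : ∀ x ∈ Set.Icc a b, W x ≤ U x := fun x hx => (hU x hx).2 _ (hW x hx).1
  have strict : ∀ e ∈ Set.Icc a b, ∀ t, 0 ≤ t → t < 1 → W ((1 - t) * z0.re + t * e) < U ((1 - t) * z0.re + t * e) := by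
    intro e he t h0 h1
    have m1 := Qv (hU _ hx0).1 (hU e he).1 (by linarith : 0 ≤ 1 - t) h0 (by ring)
    have m2 := Qv (hW _ hx0).1 (hW e he).1 (by linarith : 0 ≤ 1 - t) h0 (by ring)
    have m1' : ((1 - t) * z0.re + t * e, (1 - t) * U z0.re + t * U e) ∈ parQ K := by simpa using m1
    have m2' : ((1 - t) * z0.re + t * e, (1 - t) * W z0.re + t * W e) ∈ parQ K := by simpa using m2
    have hin := hmemQ _ m1'
    have g1 := (hU _ hin).2 _ m1'
    have g2 := (hW _ hin).2 _ m2'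
    have g3 := hWU e he
    simp only at g1 g2
    have : (1 - t) * W z0.re < (1 - t) * U z0.re := mul_lt_mul_of_pos_left hWU0 (by linarith)
    have : t * W e ≤ t * U e := mul_le_mul_of_nonneg_left g3 h0
    linarith
  have hpos : ∀ x V, (x, V) ∈ parQ K → 0 < V - x ^ 2 := by
    rintro x V ⟨z, hz, he⟩
    simp only [Prod.mk.injEq] at he
    have := z.im_pos
    rw [← he.1, ← he.2]; ring_nf; positivity
  have hcl : ∀ x, clampf a b x ∈ Set.Icc a b := fun x => clampf_mem a b x hab0
  have hcU : Continuous fun x => U (clampf a b x) := Uc.comp_continuous (continuous_clampf a b) hcl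
  have hcW : Continuous fun x => W (clampf a b x) := Wc.comp_continuous (continuous_clampf a b) hcl
  have cc := continuous_clampf a b
  have hle : ∀ x ∈ Set.Icc a b, √(W (clampf a b x) - clampf a b x ^ 2) ≤ √(U (clampf a b x) - clampf a b x ^ 2) := by
    intro x hx
    apply Real.sqrt_le_sqrt
    have := hWU _ (hcl x); linarith
  refine ⟨a, b, fun x => √(W (clampf a b x) - clampf a b x ^ 2),
    fun x => √(U (clampf a b x) - clampf a b x ^ 2), hab, (hcW.sub (cc.pow 2)).sqrt,
    (hcU.sub (cc.pow 2)).sqrt,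
    fun x => Real.sqrt_pos.2 (hpos _ _ (hW _ (hcl x)).1), ?_, hle a ⟨le_rfl, hab0⟩, hle b ⟨hab0, le_rfl⟩, ?_⟩
  · intro x hxa hxb
    simp only [clampf_of_mem hxa.le hxb.le]
    apply Real.sqrt_lt_sqrt
    · exact (hpos _ _ (hW _ ⟨hxa.le, hxb.le⟩).1).le
    · have : W x < U x := by
        rcases lt_trichotomy x z0.re with h | h | h
        · have hd : 0 < z0.re - a := by linarith
          have := strict a ⟨le_rfl, hab0⟩ ((z0.re - x) / (z0.re - a)) (by apply div_nonneg <;> linarith)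
            (by rw [div_lt_one hd]; linarith)
          have e : (1 - (z0.re - x) / (z0.re - a)) * z0.re + (z0.re - x) / (z0.re - a) * a = x := by
            field_simp; ring
          rwa [e] at this
        · rw [h]; exact hWU0
        · have hd : 0 < b - z0.re := by linarith
          have := strict b ⟨hab0, le_rfl⟩ ((x - z0.re) / (b - z0.re)) (by apply div_nonneg <;> linarith)
            (by rw [div_lt_one hd]; linarith)
          have e : (1 - (x - z0.re) / (b - z0.re)) * z0.re + (x - z0.re) / (b - z0.re) * b = x := by
            field_simp; ring
          rwa [e] at this
      linarith
  · intro p hp0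
    rw [mem_parQ K p hp0]
    have hiff : p ∈ bodyC a b (fun x => √(W (clampf a b x) - clampf a b x ^ 2))
        (fun x => √(U (clampf a b x) - clampf a b x ^ 2)) ↔
        a ≤ p.1 ∧ p.1 ≤ b ∧ W p.1 ≤ p.1 ^ 2 + p.2 ^ 2 ∧ p.1 ^ 2 + p.2 ^ 2 ≤ U p.1 := by
      unfold bodyC
      simp only [Set.mem_ofPred_eq]
      refine and_congr_right fun h1 => and_congr_right fun h2 => ?_
      rw [clampf_of_mem h1 h2, Real.sqrt_le_left hp0.le, Real.le_sqrt' hp0]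
      constructor
      · rintro ⟨g1, g2⟩; constructor <;> linarith
      · rintro ⟨g1, g2⟩; constructor <;> linarith
    rw [hiff]
    constructor
    · intro hm
      have hin := hmemQ _ hm
      exact ⟨hin.1, hin.2, (hW _ hin).2 _ hm, (hU _ hin).2 _ hm⟩
    · rintro ⟨h1, h2, h3, h4⟩
      have hin : p.1 ∈ Set.Icc a b := ⟨h1, h2⟩
      have hseg := Qv.segment_subset (hW _ hin).1 (hU _ hin).1
      apply hseg
      rw [segment_eq_image]
      rcases (hWU _ hin).eq_or_lt with h | h
      · refine ⟨0, by simp, ?_⟩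
        simp; linarith
      · have hd : 0 < U p.1 - W p.1 := by linarith
        refine ⟨(p.1 ^ 2 + p.2 ^ 2 - W p.1) / (U p.1 - W p.1), ⟨by apply div_nonneg <;> linarith, by rw [div_le_one hd]; linarith⟩, ?_⟩
        ext
        · simp; ring
        · simp; field_simp; ring


lemma hp_inj {p q : ℝ × ℝ} (h1 : 0 < p.2) (h2 : 0 < q.2) (h : hp p = hp q) : p = q := by
  ext
  · rw [← hp_re h1, ← hp_re h2, h]
  · rw [← hp_im h1, ← hp_im h2, h]

lemma frontier_of (K : Set ℍ) (a b : ℝ) (l u : ℝ → ℝ)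
    (hlpos : ∀ x, 0 < l x)
    (hbody : ∀ p : ℝ × ℝ, 0 < p.2 → (hp p ∈ K ↔ p ∈ bodyC a b l u))
    (p : ℝ × ℝ) (hpb : p ∈ bodyC a b l u)
    (h : p.1 = a ∨ p.1 = b ∨ p.2 = l p.1 ∨ p.2 = u p.1) : hp p ∈ frontier K := by
  have hp0 : 0 < p.2 := (hlpos p.1).trans_le hpb.2.2.1
  have hpK : hp p ∈ K := (hbody p hp0).2 hpb
  refine ⟨subset_closure hpK, fun hmemint => ?_⟩
  have hpos : {q : ℝ × ℝ | 0 < q.2} ∈ nhds p :=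
    (isOpen_lt continuous_const continuous_snd).mem_nhds hp0
  have hct : ContinuousAt hp p := continuousOn_hp.continuousAt hpos
  have hnear : ∀ᶠ q : ℝ × ℝ in nhds p, hp q ∈ K :=
    hct.eventually_mem (mem_interior_iff_mem_nhds.1 hmemint)
  have hb : ∀ᶠ q : ℝ × ℝ in nhds p, q ∈ bodyC a b l u := by
    filter_upwards [hnear, hpos] with q h1 h2
    exact (hbody q h2).1 h1
  have hdir : ∀ v : ℝ × ℝ, ∃ s : ℝ, 0 < s ∧ (p.1 + s * v.1, p.2 + s * v.2) ∈ bodyC a b l u := by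
    intro v
    have hc : Filter.Tendsto (fun s : ℝ => (p.1 + s * v.1, p.2 + s * v.2)) (nhds 0) (nhds p) := by
      have : Continuous (fun s : ℝ => (p.1 + s * v.1, p.2 + s * v.2)) := by fun_prop
      have h := this.tendsto 0
      simpa using h
    have h1 : ∀ᶠ s in nhdsWithin (0:ℝ) (Set.Ioi 0), (p.1 + s * v.1, p.2 + s * v.2) ∈ bodyC a b l u :=
      nhdsWithin_le_nhds (hc.eventually hb)
    obtain ⟨s, h2, h3⟩ := (h1.and self_mem_nhdsWithin).exists
    exact ⟨s, h3, h2⟩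
  rcases h with h | h | h | h
  · obtain ⟨s, s0, m1, m2, m3, m4⟩ := hdir (-1, 0)
    simp only at m1; linarith
  · obtain ⟨s, s0, m1, m2, m3, m4⟩ := hdir (1, 0)
    simp only at m2; linarith
  · obtain ⟨s, s0, m1, m2, m3, m4⟩ := hdir (0, -1)
    simp only [mul_zero, add_zero] at m3; linarith
  · obtain ⟨s, s0, m1, m2, m3, m4⟩ := hdir (0, 1)
    simp only [mul_zero, add_zero] at m4; linarith

lemma len_le (K : Set ℍ) (a b : ℝ) (hab : a < b) (l u : ℝ → ℝ)
    (hl : Continuous l) (hu : Continuous u) (hlpos : ∀ x, 0 < l x)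
    (hlu : ∀ x, a < x → x < b → l x < u x) (hlua : l a ≤ u a) (hlub : l b ≤ u b)
    (hbody : ∀ p : ℝ × ℝ, 0 < p.2 → (hp p ∈ K ↔ p ∈ bodyC a b l u)) (n : ℕ) :
    ∑ j ∈ Finset.range n, ENNReal.ofReal (dist (hp (lowC l (grid a b n j)))
        (hp (lowC l (grid a b n (j+1))))) +
      ∑ j ∈ Finset.range n, ENNReal.ofReal
        (dist (hp (uppC a b u (grid (a - (u a - l a)) (b + (u b - l b)) n j)))
        (hp (uppC a b u (grid (a - (u a - l a)) (b + (u b - l b)) n (j+1))))) ≤ μH[1] (frontier K) := by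
  set tL := a - (u a - l a) with htL
  set tR := b + (u b - l b) with htR
  have htLR : tL ≤ tR := by linarith
  have hlu' : ∀ x, a ≤ x → x ≤ b → l x ≤ u x := by
    intro x h1 h2
    rcases h1.eq_or_lt with rfl | h3
    · exact hlua
    · rcases h2.eq_or_lt with rfl | h4
      · exact hlub
      · exact (hlu x h3 h4).le
  have low_mem : ∀ t ∈ Set.Icc a b, lowC l t ∈ bodyC a b l u := fun t ht =>
    ⟨ht.1, ht.2, le_rfl, hlu' t ht.1 ht.2⟩
  have upp_mem : ∀ t ∈ Set.Icc tL tR, uppC a b u t ∈ bodyC a b l u ∧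
      ((uppC a b u t).1 = a ∨ (uppC a b u t).1 = b ∨ (uppC a b u t).2 = l (uppC a b u t).1 ∨
        (uppC a b u t).2 = u (uppC a b u t).1) := by
    intro t ht
    rcases le_total t a with h | h
    · simp only [uppC, clampf_of_le h hab.le]
      rw [abs_of_nonpos (by linarith)]
      have h2 := ht.1
      exact ⟨⟨le_rfl, hab.le, by simp only; linarith, by simp only; linarith⟩, by simp⟩
    · rcases le_total t b with h' | h'
      · rw [uppC_of_mem u h h']
        exact ⟨⟨h, h', hlu' t h h', le_rfl⟩, Or.inr (Or.inr (Or.inr rfl))⟩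
      · simp only [uppC, clampf_of_ge h' hab.le]
        rw [abs_of_nonneg (by linarith)]
        have h2 := ht.2
        exact ⟨⟨hab.le, le_rfl, by simp only; linarith, by simp only; linarith⟩, by simp⟩
  have posb : ∀ p ∈ bodyC a b l u, 0 < p.2 := fun p h => (hlpos p.1).trans_le h.2.2.1
  have hcl : ContinuousOn (fun t => hp (lowC l t)) (Set.Icc a b) :=
    continuousOn_hp.comp (continuous_lowC l hl).continuousOn fun t ht => posb _ (low_mem t ht)
  have hcu : ContinuousOn (fun t => hp (uppC a b u t)) (Set.Icc tL tR) :=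
    continuousOn_hp.comp (continuous_uppC a b u hu).continuousOn fun t ht => posb _ (upp_mem t ht).1
  have hil : Set.InjOn (fun t => hp (lowC l t)) (Set.Ioo a b) := by
    intro s hs t ht h
    have := hp_inj (posb _ (low_mem s (Set.Ioo_subset_Icc_self hs)))
      (posb _ (low_mem t (Set.Ioo_subset_Icc_self ht))) h
    simpa [lowC] using congrArg Prod.fst this
  have inju : Function.Injective (uppC a b u) := by
    intro s t h
    simp only [uppC, Prod.mk.injEq] at h
    obtain ⟨h1, h2⟩ := h
    rw [h1] at h2
    have h3 : |s - clampf a b t| = |t - clampf a b t| := by linarith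
    rcases abs_eq_abs.1 h3 with h4 | h4
    · linarith
    · by_contra hne
      have aux : ∀ v, v < clampf a b v → clampf a b v = a := by
        intro v hv
        rcases le_total v a with g | g
        · exact clampf_of_le g hab.le
        · rcases le_total v b with g' | g'
          · rw [clampf_of_mem g g'] at hv; linarith
          · rw [clampf_of_ge g' hab.le] at hv; linarith
      have aux2 : ∀ v, clampf a b v < v → clampf a b v = b := by
        intro v hv
        rcases le_total v a with g | g
        · rw [clampf_of_le g hab.le] at hv; linarith
        · rcases le_total v b with g' | g'
          · rw [clampf_of_mem g g'] at hv; linarith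
          · exact clampf_of_ge g' hab.le
      rcases lt_trichotomy t (clampf a b t) with g | g | g
      · have := aux t g
        have := aux2 s (by rw [h1]; linarith)
        linarith
      · apply hne; linarith
      · have := aux2 t g
        have := aux s (by rw [h1]; linarith)
        linarith
  have hiu : Set.InjOn (fun t => hp (uppC a b u t)) (Set.Ioo tL tR) := by
    intro s hs t ht h
    exact inju (hp_inj (posb _ (upp_mem s (Set.Ioo_subset_Icc_self hs)).1)
      (posb _ (upp_mem t (Set.Ioo_subset_Icc_self ht)).1) h)
  have g1 := sum_dist_le_hausdorff (fun t => hp (lowC l t)) a b hcl hil (grid a b n)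
    (grid_mono a b hab.le n) n (grid_zero a b n).ge (grid_last_le a b hab.le n)
  have g2 := sum_dist_le_hausdorff (fun t => hp (uppC a b u t)) tL tR hcu hiu (grid tL tR n)
    (grid_mono tL tR htLR n) n (grid_zero tL tR n).ge (grid_last_le tL tR htLR n)
  refine (add_le_add g1 g2).trans ?_
  have hmeas : MeasurableSet ((fun t => hp (uppC a b u t)) '' Set.Ioo tL tR) :=
    measurableSet_Ioo.image_of_continuousOn_injOn (hcu.mono Set.Ioo_subset_Icc_self) hiu
  rw [← measure_union _ hmeas]
  · apply measure_mono
    rintro _ (⟨t, ht, rfl⟩ | ⟨t, ht, rfl⟩)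
    · exact frontier_of K a b l u hlpos hbody _ (low_mem t (Set.Ioo_subset_Icc_self ht))
        (Or.inr (Or.inr (Or.inl rfl)))
    · have := upp_mem t (Set.Ioo_subset_Icc_self ht)
      exact frontier_of K a b l u hlpos hbody _ this.1 this.2
  · rw [Set.disjoint_left]
    rintro _ ⟨t, ht, rfl⟩ ⟨s, hs, h⟩
    have h' := hp_inj (posb _ (upp_mem s (Set.Ioo_subset_Icc_self hs)).1)
      (posb _ (low_mem t (Set.Ioo_subset_Icc_self ht))) h
    simp only [uppC, lowC, Prod.mk.injEq] at h'
    obtain ⟨e1, e2⟩ := h'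
    have hst : s = t := by
      rcases le_total s a with g | g
      · rw [clampf_of_le g hab.le] at e1; have := ht.1; linarith
      · rcases le_total s b with g' | g'
        · rwa [clampf_of_mem g g'] at e1
        · rw [clampf_of_ge g' hab.le] at e1; have := ht.2; linarith
    rw [e1, hst] at e2
    have := hlu t ht.1 ht.2
    simp at e2; linarith

/-- main integral-geometric inequality -/
lemma main_K (K : Set ℍ) (hK : IsCompact K) (hc : HypConvex K) (hi : (interior K).Nonempty)
    (hL : μH[1] (frontier K) ≠ ⊤) (r : ℝ) (hr : 0 < r)
    (hD : ∃ c0 : ℍ, ∀ c : ℍ, c ≠ c0 → ¬ Metric.closedBall c r ⊆ K ∧ ¬ K ⊆ Metric.closedBall c r) :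
    hypAreaMeasure K ≠ ⊤ ∧ cosh r * hypArea K + 2 * π * (cosh r - 1) ≤ sinh r * hypPerim K := by
  obtain ⟨a, b, l, u, hab, hl, hu, hlpos, hlu, hlua, hlub, hbody⟩ := structK K hK hc hi
  have hS : 0 < sinh r := Real.sinh_pos_iff.2 hr
  have hC : 0 < cosh r := Real.cosh_pos r
  have posb : ∀ p ∈ bodyC a b l u, 0 < p.2 := fun p h => (hlpos p.1).trans_le h.2.2.1
  have hset : {p : ℝ × ℝ | 0 < p.2 ∧ hp p ∈ K} = bodyC a b l u := by
    ext p
    constructor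
    · rintro ⟨h1, h2⟩; exact (hbody p h1).1 h2
    · intro h; exact ⟨posb p h, (hbody p (posb p h)).2 h⟩
  have hbm : MeasurableSet (bodyC a b l u) := by
    have o1 : IsClosed {p : ℝ × ℝ | a ≤ p.1} := isClosed_le continuous_const continuous_fst
    have o2 : IsClosed {p : ℝ × ℝ | p.1 ≤ b} := isClosed_le continuous_fst continuous_const
    have o3 : IsClosed {p : ℝ × ℝ | l p.1 ≤ p.2} := isClosed_le (hl.comp continuous_fst) continuous_snd
    have o4 : IsClosed {p : ℝ × ℝ | p.2 ≤ u p.1} := isClosed_le continuous_snd (hu.comp continuous_fst)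
    exact (o1.inter (o2.inter (o3.inter o4))).measurableSet
  obtain ⟨gm, g0⟩ := null_graph a b l u hl hu
  have harea : hypAreaMeasure K = ∫⁻ p in bodyO a b l u, ENNReal.ofReal ((p.2 ^ 2)⁻¹) := by
    rw [hypAreaMeasure_eq K hK.isClosed.measurableSet (by rw [hset]; exact hbm), hset]
    apply setLIntegral_congr
    rw [Filter.eventuallyEq_set]
    filter_upwards [measure_eq_zero_iff_ae_notMem.1 g0] with p hpn
    simp only [Set.mem_ofPred_eq, not_or] at hpn
    obtain ⟨n1, n2, n3, n4⟩ := hpn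
    constructor
    · rintro ⟨h1, h2, h3, h4⟩
      exact ⟨lt_of_le_of_ne h1 (Ne.symm n1), lt_of_le_of_ne h2 n2, lt_of_le_of_ne h3 (Ne.symm n3),
        lt_of_le_of_ne h4 n4⟩
    · intro h
      exact ⟨h.1.le, h.2.1.le, h.2.2.1.le, h.2.2.2.le⟩
  have hD' : ∀ᵐ c : ℝ × ℝ, 0 < c.2 →
      (∃ p : ℝ × ℝ, (p.1 - c.1) ^ 2 + (p.2 - cosh r / c.2) ^ 2 ≤ (sinh r / c.2) ^ 2 ∧ p ∉ bodyC a b l u) ∧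
      (∃ p ∈ bodyC a b l u, (sinh r / c.2) ^ 2 < (p.1 - c.1) ^ 2 + (p.2 - cosh r / c.2) ^ 2) := by
    obtain ⟨c0, hc0⟩ := hD
    have hae : ∀ᵐ c : ℝ × ℝ, c ≠ (c0.re, c0.im⁻¹) := by
      rw [ae_iff]; simp
    filter_upwards [hae] with c hne hc2
    have hinv : 0 < ((c.1, c.2⁻¹) : ℝ × ℝ).2 := inv_pos.2 hc2
    set z := hp (c.1, c.2⁻¹) with hz
    have zre : z.re = c.1 := hp_re hinv
    have zim : z.im = c.2⁻¹ := hp_im hinv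
    have hzne : z ≠ c0 := by
      rintro h
      apply hne
      ext
      · rw [← zre, h]
      · rw [← h, zim, inv_inv]
    have hball : ∀ w : ℍ, w ∈ Metric.closedBall z r ↔
        (w.re - c.1) ^ 2 + (w.im - cosh r / c.2) ^ 2 ≤ (sinh r / c.2) ^ 2 := by
      intro w
      rw [Metric.mem_closedBall, UpperHalfPlane.dist_le_iff_dist_coe_center_le, Complex.dist_eq,
        ← abs_of_nonneg (norm_nonneg _), ← abs_of_nonneg (a := z.im * sinh r) (by have := z.im_pos; positivity),
        ← sq_le_sq, Complex.sq_norm, Complex.normSq_apply]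
      simp only [Complex.sub_re, Complex.sub_im, UpperHalfPlane.coe_re, UpperHalfPlane.coe_im,
        UpperHalfPlane.center_re, UpperHalfPlane.center_im, zre, zim]
      have e1 : c.2⁻¹ * cosh r = cosh r / c.2 := by ring
      have e2 : c.2⁻¹ * sinh r = sinh r / c.2 := by ring
      rw [e1, e2, ← sq, ← sq]
    obtain ⟨d1, d2⟩ := hc0 z hzne
    rw [Set.not_subset] at d1 d2
    obtain ⟨w1, a1, b1⟩ := d1
    obtain ⟨w2, a2, b2⟩ := d2
    constructor
    · refine ⟨(w1.re, w1.im), (hball w1).1 a1, fun h => b1 ?_⟩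
      rw [← hp_self w1]; exact (hbody (w1.re, w1.im) w1.im_pos).2 h
    · refine ⟨(w2.re, w2.im), (hbody (w2.re, w2.im) w2.im_pos).1 (by rw [hp_self]; exact a2), ?_⟩
      rw [hball] at b2
      exact not_le.1 b2
  have hmain := main_coord r hr a b hab l u hl hu hlpos hlu hlua hlub _ hL
    (len_le K a b hab l u hl hu hlpos hlu hlua hlub hbody) hD'
  rw [← harea] at hmain
  have hRfin : ENNReal.ofReal (2 * sinh r) * μH[1] (frontier K) ≠ ⊤ :=
    ENNReal.mul_ne_top ENNReal.ofReal_ne_top hL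
  have hAfin : hypAreaMeasure K ≠ ⊤ := by
    intro h
    rw [h, ENNReal.mul_top (by simpa using hC)] at hmain
    rw [ENNReal.mul_top (by norm_num), top_add, top_le_iff] at hmain
    exact hRfin hmain
  refine ⟨hAfin, ?_⟩
  have hC1 : 0 ≤ cosh r - 1 := by have := Real.one_le_cosh r; linarith
  have := ENNReal.toReal_mono hRfin hmain
  rw [ENNReal.toReal_add (by finiteness) (by finiteness)] at this
  simp only [ENNReal.toReal_mul, ENNReal.toReal_ofNat] at this
  rw [ENNReal.toReal_ofReal hC.le, ENNReal.toReal_ofReal (by positivity), ENNReal.toReal_ofReal (by positivity)] at this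
  unfold hypArea hypPerim
  linarith


/-- denominators for the Klein model centred at `c` -/
def kN (c z : ℍ) : ℝ := (z.re - c.re) ^ 2 + z.im ^ 2 + c.im ^ 2

/-- Klein model centred at `c` -/
noncomputable def klein (c z : ℍ) : ℂ := ⟨2 * c.im * (z.re - c.re) / kN c z, 1 - 2 * c.im ^ 2 / kN c z⟩

lemma kN_pos (c z : ℍ) : 0 < kN c z := by
  have := z.im_pos
  have := c.im_pos
  unfold kN; positivity

lemma kN_eq (c z : ℍ) : kN c z = 2 * c.im * z.im * cosh (dist c z) := by
  have h1 := z.im_pos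
  have h2 := c.im_pos
  rw [cosh_dist_hp']; unfold kN; field_simp; ring

lemma continuous_klein (c : ℍ) : Continuous (klein c) := by
  have h1 := UpperHalfPlane.continuous_re
  have h2 := UpperHalfPlane.continuous_im
  have hN : Continuous (kN c) := by unfold kN; fun_prop
  have hne : ∀ z, kN c z ≠ 0 := fun z => (kN_pos c z).ne'
  have e : klein c = fun z => ((2 * c.im * (z.re - c.re) / kN c z : ℝ) : ℂ) +
      ((1 - 2 * c.im ^ 2 / kN c z : ℝ) : ℂ) * Complex.I := by
    funext z; apply Complex.ext
    · simp only [klein, Complex.add_re, Complex.ofReal_re, Complex.re_ofReal_mul, Complex.I_re]; ring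
    · simp only [klein, Complex.add_im, Complex.ofReal_im, Complex.im_ofReal_mul, Complex.I_im]; ring
  rw [e]
  have g1 : Continuous fun z => 2 * c.im * (z.re - c.re) / kN c z := Continuous.div (by fun_prop) hN hne
  have g2 : Continuous fun z => 1 - 2 * c.im ^ 2 / kN c z :=
    continuous_const.sub (Continuous.div (by fun_prop) hN hne)
  exact (Complex.continuous_ofReal.comp g1).add ((Complex.continuous_ofReal.comp g2).mul continuous_const)

lemma sinh_sq_klein (c z w : ℍ) :
    sinh (dist z w) ^ 2 ≤ (cosh (dist c z) * cosh (dist c w)) ^ 2 * ‖klein c z - klein c w‖ ^ 2 := by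
  have p0 := c.im_pos
  have p1 := z.im_pos
  have p2 := w.im_pos
  have hN1 := kN_pos c z
  have hN2 := kN_pos c w
  have e1 : cosh (dist c z) = kN c z / (2 * c.im * z.im) := by
    rw [kN_eq]; field_simp
  have e2 : cosh (dist c w) = kN c w / (2 * c.im * w.im) := by
    rw [kN_eq]; field_simp
  have hid : sinh (dist z w) ^ 2 = (cosh (dist c z) * cosh (dist c w)) ^ 2 *
      (‖klein c z - klein c w‖ ^ 2 - ((klein c z).re * (klein c w).im - (klein c z).im * (klein c w).re) ^ 2) := by
    rw [Real.sinh_sq, cosh_dist_hp', e1, e2, Complex.sq_norm, Complex.normSq_apply]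
    simp only [Complex.sub_re, Complex.sub_im, klein]
    generalize hn1 : kN c z = N1 at *
    generalize hn2 : kN c w = N2 at *
    field_simp
    rw [← hn1, ← hn2]
    unfold kN
    ring
  rw [hid]
  apply mul_le_mul_of_nonneg_left _ (by positivity)
  have := sq_nonneg ((klein c z).re * (klein c w).im - (klein c z).im * (klein c w).re)
  linarith

lemma norm_klein_sq (c z : ℍ) : ‖klein c z‖ ^ 2 = 1 - (cosh (dist c z) ^ 2)⁻¹ := by
  have p0 := c.im_pos
  have p1 := z.im_pos
  have hN1 := kN_pos c z
  have e1 : cosh (dist c z) = kN c z / (2 * c.im * z.im) := by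
    rw [kN_eq]; field_simp
  rw [e1, Complex.sq_norm, Complex.normSq_apply]
  simp only [klein]
  generalize hn1 : kN c z = N1 at *
  field_simp
  rw [← hn1]
  unfold kN
  ring

lemma klein_inj (c z w : ℍ) (h : klein c z = klein c w) : z = w := by
  have := sinh_sq_klein c z w
  rw [h, sub_self, norm_zero] at this
  have h0 : sinh (dist z w) = 0 := by
    apply pow_eq_zero_iff two_ne_zero |>.1
    apply le_antisymm _ (sq_nonneg _)
    simpa using this
  exact dist_eq_zero.1 (Real.sinh_eq_zero.1 h0)

lemma klein_convex (c : ℍ) (K : Set ℍ) (hK : HypConvex K) : Convex ℝ (klein c '' K) := by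
  rintro _ ⟨z1, k1, rfl⟩ _ ⟨z2, k2, rfl⟩ s t hs ht hst
  have p0 := c.im_pos
  have N1 := kN_pos c z1
  have N2 := kN_pos c z2
  set s1 := s / kN c z1 with hs1
  set s2 := t / kN c z2 with hs2
  have q1 : 0 ≤ s1 := by positivity
  have q2 : 0 ≤ s2 := by positivity
  have hσ : 0 < s1 + s2 := by
    rcases hs.eq_or_lt with h | h
    · have : 0 < t := by linarith
      positivity
    · positivity
  have a1 : s1 * kN c z1 = s := by rw [hs1]; field_simp
  have a2 : s2 * kN c z2 = t := by rw [hs2]; field_simp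
  have hm := parQ_convex K hK ⟨z1, k1, rfl⟩ ⟨z2, k2, rfl⟩ (a := s1 / (s1 + s2)) (b := s2 / (s1 + s2))
    (by positivity) (by positivity) (by field_simp)
  obtain ⟨z, hz, he⟩ := hm
  refine ⟨z, hz, ?_⟩
  simp only [Prod.smul_mk, smul_eq_mul, Prod.mk_add_mk, Prod.mk.injEq] at he
  obtain ⟨hx, hW⟩ := he
  have hx' : (s1 + s2) * z.re = s1 * z1.re + s2 * z2.re := by rw [hx]; field_simp
  have hW' : (s1 + s2) * (z.re ^ 2 + z.im ^ 2) = s1 * (z1.re ^ 2 + z1.im ^ 2) + s2 * (z2.re ^ 2 + z2.im ^ 2) := by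
    rw [hW]; field_simp
  have hN : (s1 + s2) * kN c z = 1 := by
    rw [← hst, ← a1, ← a2]; unfold kN
    linear_combination hW' - 2 * c.re * hx'
  have hNz := kN_pos c z
  have hNi : (kN c z)⁻¹ = s1 + s2 := by
    rw [inv_eq_one_div, div_eq_iff hNz.ne']; exact hN.symm
  have i1 : s * (kN c z1)⁻¹ = s1 := by rw [hs1]; ring
  have i2 : t * (kN c z2)⁻¹ = s2 := by rw [hs2]; ring
  apply Complex.ext
  · simp only [klein, Complex.add_re, Complex.smul_re, smul_eq_mul, div_eq_mul_inv, hNi]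
    linear_combination 2 * c.im * hx' - 2 * c.im * (z1.re - c.re) * i1 - 2 * c.im * (z2.re - c.re) * i2
  · simp only [klein, Complex.add_im, Complex.smul_im, smul_eq_mul, div_eq_mul_inv, hNi]
    linear_combination - hst + 2 * c.im ^ 2 * i1 + 2 * c.im ^ 2 * i2

lemma proj_lip {E : Type*} [NormedAddCommGroup E] [InnerProductSpace ℝ E] (C : Set E) (u v p q : E)
    (hp : p ∈ C) (hq : q ∈ C) (h1 : ∀ w ∈ C, inner ℝ (u - p) (w - p) ≤ 0)
    (h2 : ∀ w ∈ C, inner ℝ (v - q) (w - q) ≤ 0) : ‖p - q‖ ≤ ‖u - v‖ := by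
  have g1 := h1 q hq
  have g2 := h2 p hp
  have e : inner ℝ (u - p) (q - p) + inner ℝ (v - q) (p - q) =
      ‖p - q‖ ^ 2 - inner ℝ (u - v) (p - q) := by
    rw [← real_inner_self_eq_norm_sq]
    simp only [inner_sub_left, inner_sub_right]
    ring
  have h3 := real_inner_le_norm (u - v) (p - q)
  rcases (norm_nonneg (p - q)).eq_or_lt with h | h
  · rw [← h]; exact norm_nonneg _
  · nlinarith

lemma perim_bound (K : Set ℍ) (hK : IsCompact K) (hc : HypConvex K) (hne : K.Nonempty) (c : ℍ)
    (hsub : K ⊆ Metric.closedBall c (Real.log (1 + √2))) :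
    μH[1] (frontier K) ≤ ENNReal.ofReal (2 * √2 * π) := by
  have hs2 : √2 ^ 2 = 2 := Real.sq_sqrt (by norm_num)
  have hs0 : 0 < √2 := by positivity
  have hcosh : cosh (Real.log (1 + √2)) = √2 := by
    rw [Real.cosh_log (by positivity)]
    field_simp
    nlinarith
  have hck : ∀ z ∈ K, cosh (dist c z) ≤ √2 := by
    intro z hz
    rw [← hcosh]
    apply Real.cosh_le_cosh.2
    rw [abs_of_nonneg dist_nonneg, dist_comm]
    exact (hsub hz).trans (le_abs_self _)
  set ρ : ℝ := √2 / 2 with hρ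
  have hρ0 : 0 < ρ := by positivity
  set C := klein c '' K with hC
  have hCc : IsCompact C := hK.image (continuous_klein c)
  have hCv : Convex ℝ C := klein_convex c K hc
  have hCne : C.Nonempty := hne.image _
  have hCρ : ∀ w ∈ C, ‖w‖ ≤ ρ := by
    rintro _ ⟨z, hz, rfl⟩
    refine (sq_le_sq₀ (norm_nonneg _) hρ0.le).1 ?_
    rw [norm_klein_sq]
    have h1 := hck z hz
    have h2 := Real.cosh_pos (dist c z)
    have h3 : (2:ℝ)⁻¹ ≤ (cosh (dist c z) ^ 2)⁻¹ := by
      apply inv_anti₀ (by positivity)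
      nlinarith
    rw [hρ, div_pow, hs2]; norm_num at h3 ⊢; linarith
  have hlip : ∀ z ∈ K, ∀ w ∈ K, dist z w ≤ 2 * ‖klein c z - klein c w‖ := by
    intro z hz w hw
    have h1 := sinh_sq_klein c z w
    have h2 := hck z hz
    have h3 := hck w hw
    have h4 := Real.cosh_pos (dist c z)
    have h5 := Real.cosh_pos (dist c w)
    have h6 : cosh (dist c z) * cosh (dist c w) ≤ 2 := by
      calc _ ≤ √2 * √2 := mul_le_mul h2 h3 h5.le hs0.le
        _ = 2 := by nlinarith
    have h7 : sinh (dist z w) ≤ 2 * ‖klein c z - klein c w‖ := by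
      refine (sq_le_sq₀ (Real.sinh_nonneg_iff.2 dist_nonneg) (by positivity)).1 ?_
      refine h1.trans ?_
      rw [mul_pow 2]
      gcongr
    exact (Real.self_le_sinh_iff.2 dist_nonneg).trans h7
  -- projection
  have hproj : ∀ w : ℂ, ∃ z ∈ K, ∀ v ∈ C, inner ℝ (w - klein c z) (v - klein c z) ≤ 0 := by
    intro w
    obtain ⟨v, hv, he⟩ := exists_norm_eq_iInf_of_complete_convex hCne hCc.isComplete hCv w
    obtain ⟨z, hz, rfl⟩ := hv
    exact ⟨z, hz, (norm_eq_iInf_iff_real_inner_le_zero hCv ⟨z, hz, rfl⟩).1 he⟩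
  choose P hPK hP using hproj
  have hPlip : ∀ u v, dist (P u) (P v) ≤ 2 * ‖u - v‖ := fun u v =>
    (hlip _ (hPK u) _ (hPK v)).trans (mul_le_mul_of_nonneg_left
      (proj_lip C u v _ _ ⟨_, hPK u, rfl⟩ ⟨_, hPK v, rfl⟩ (hP u) (hP v)) (by norm_num))
  have hPu : ∀ u, ∀ z ∈ K, (∀ v ∈ C, inner ℝ (u - klein c z) (v - klein c z) ≤ 0) → P u = z := by
    intro u z hz h
    apply klein_inj c
    have := proj_lip C u u _ _ ⟨_, hPK u, rfl⟩ ⟨_, hz, rfl⟩ (hP u) h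
    rw [sub_self, norm_zero] at this
    exact sub_eq_zero.1 (norm_le_zero_iff.1 this)
  set f : ℝ → ℍ := fun θ => P (circleMap 0 ρ θ) with hf
  have hflip : LipschitzWith (Real.toNNReal (2 * ρ)) f := by
    apply LipschitzWith.of_dist_le_mul
    intro x y
    rw [Real.coe_toNNReal _ (by positivity)]
    have h1 := (lipschitzWith_circleMap 0 ρ).dist_le_mul x y
    rw [dist_eq_norm (circleMap 0 ρ x)] at h1
    have h2 := hPlip (circleMap 0 ρ x) (circleMap 0 ρ y)
    have h3 : ((Real.nnabs ρ : NNReal) : ℝ) = ρ := by simp [abs_of_pos hρ0]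
    rw [h3] at h1
    calc dist (f x) (f y) ≤ 2 * (ρ * dist x y) := h2.trans (by gcongr)
      _ = _ := by ring
  have hcov : frontier K ⊆ f '' Set.Icc 0 (2 * π) := by
    have hcl : IsClosed (f '' Set.Icc 0 (2 * π)) := (isCompact_Icc.image hflip.continuous).isClosed
    have hout : ∀ z, z ∉ K → P (klein c z) ∈ f '' Set.Icc 0 (2 * π) := by
      intro z hz
      set q := klein c (P (klein c z)) with hq
      set v := klein c z - q with hv
      have hv0 : v ≠ 0 := by
        intro h
        apply hz
        have : klein c z = q := sub_eq_zero.1 h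
        rw [klein_inj c _ _ this]; exact hPK _
      have hqC : q ∈ C := ⟨_, hPK _, rfl⟩
      have hnv : 0 < ‖v‖ := norm_pos_iff.2 hv0
      set T := 2 * ρ / ‖v‖ with hT
      have hT0 : 0 ≤ T := by positivity
      have hcont : ContinuousOn (fun t : ℝ => ‖q + t • v‖) (Set.Icc 0 T) := by fun_prop
      have hivt := intermediate_value_Icc hT0 hcont
      have hmem : ρ ∈ Set.Icc ‖q + (0:ℝ) • v‖ ‖q + T • v‖ := by
        constructor
        · simpa using hCρ q hqC
        · have h1 : ‖T • v‖ = 2 * ρ := by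
            rw [norm_smul, Real.norm_of_nonneg hT0, hT]; field_simp
          have h2 : ‖T • v‖ ≤ ‖q + T • v‖ + ‖q‖ := by
            have := norm_sub_le (q + T • v) q
            simpa using this
          have := hCρ q hqC
          linarith
      obtain ⟨t, ht, hte⟩ := hivt hmem
      simp only at hte
      have hPt : P (q + t • v) = P (klein c z) := by
        apply hPu _ _ (hPK _)
        intro w hw
        have := hP (klein c z) w hw
        rw [← hq, add_sub_cancel_left, real_inner_smul_left]
        exact mul_nonpos_of_nonneg_of_nonpos ht.1 this
      have hin : q + t • v ∈ circleMap 0 ρ '' Set.Ioc 0 (2 * π) := by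
        rw [image_circleMap_Ioc]
        rw [mem_sphere_zero_iff_norm, hte, abs_of_pos hρ0]
      obtain ⟨θ, hθ, he⟩ := hin
      refine ⟨θ, Set.Ioc_subset_Icc_self hθ, ?_⟩
      rw [hf]; simp only; rw [he, hPt]
    intro z hz
    have hzK : z ∈ K := hK.isClosed.frontier_subset hz
    have hPc : Continuous P := by
      have : LipschitzWith 2 P := LipschitzWith.of_dist_le_mul fun u v => by
        rw [dist_eq_norm u v]; exact hPlip u v
      exact this.continuous
    have hPz : P (klein c z) = z := hPu _ z hzK (by intro v _; simp)
    rw [← hPz]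
    have hzc : z ∈ closure Kᶜ := by
      rw [frontier_eq_closure_inter_closure] at hz; exact hz.2
    have hmaps : Set.MapsTo (fun z => P (klein c z)) Kᶜ (f '' Set.Icc 0 (2 * π)) := fun z hz => hout z hz
    have := hmaps.closure (hPc.comp (continuous_klein c)) hzc
    rwa [hcl.closure_eq] at this
  calc μH[1] (frontier K) ≤ μH[1] (f '' Set.Icc 0 (2 * π)) := measure_mono hcov
    _ ≤ (Real.toNNReal (2 * ρ) : ENNReal) ^ (1:ℝ) * μH[1] (Set.Icc (0:ℝ) (2 * π)) :=
        hflip.hausdorffMeasure_image_le zero_le_one _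
    _ = ENNReal.ofReal (2 * √2 * π) := by
        rw [ENNReal.rpow_one, hausdorffMeasure_real, Real.volume_Icc]
        change ENNReal.ofReal _ * _ = _
        rw [← ENNReal.ofReal_mul (by positivity)]
        congr 1; rw [hρ]; ring


lemma final_alg (A P s1 s2 C1 C2 : ℝ) (hA : 0 ≤ A) (hP : 0 ≤ P) (hP2 : P ≤ 2 * √2 * π)
    (h1 : 0 ≤ s1) (h12 : s1 ≤ s2) (h2 : s2 ≤ 1) (hC1 : C1 ^ 2 = s1 ^ 2 + 1) (hC2 : C2 ^ 2 = s2 ^ 2 + 1)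
    (hC1p : 0 ≤ C1) (hC2p : 0 ≤ C2)
    (m1 : C1 * A + 2 * π * (C1 - 1) ≤ s1 * P) (m2 : C2 * A + 2 * π * (C2 - 1) ≤ s2 * P) :
    P ^ 2 - A * (4 * π + A) ≥ (s2 - s1) ^ 2 * ((2 * π + A) ^ 2 - P ^ 2) ^ 2 / (4 * (2 * π + A) ^ 2) := by
  have hπ := Real.pi_pos
  set B := 2 * π + A with hB
  have hBp : 2 * π ≤ B := by linarith
  have hB0 : 0 < B := by linarith
  set a := B ^ 2 - P ^ 2 with ha
  set D := P ^ 2 - A * (4 * π + A) with hD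
  have hDB : D = 4 * π ^ 2 - a := by rw [hD, ha, hB]; ring
  rw [ge_iff_le, div_le_iff₀ (by positivity)]
  have q : ∀ s C : ℝ, 0 ≤ s → 0 ≤ C → C ^ 2 = s ^ 2 + 1 → C * A + 2 * π * (C - 1) ≤ s * P →
      a * s ^ 2 - 4 * π * P * s + (B ^ 2 - 4 * π ^ 2) ≤ 0 := by
    intro s C hs hC hCs hm
    have h3 : C * B ≤ 2 * π + s * P := by rw [hB]; linarith
    have h4 : (C * B) ^ 2 ≤ (2 * π + s * P) ^ 2 := pow_le_pow_left₀ (by positivity) h3 2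
    rw [mul_pow, hCs] at h4
    rw [ha]; nlinarith
  rcases le_or_gt 0 a with h | h
  · have k : ∀ s : ℝ, a * s ^ 2 - 4 * π * P * s + (B ^ 2 - 4 * π ^ 2) ≤ 0 →
        (a * s - 2 * π * P) ^ 2 ≤ B ^ 2 * D := by
      intro s hs
      have := mul_nonneg h (neg_nonneg.2 hs)
      rw [hDB]
      have e : P ^ 2 = B ^ 2 - a := by rw [ha]; ring
      nlinarith
    have k1 := k s1 (q s1 C1 h1 hC1p hC1 m1)
    have k2 := k s2 (q s2 C2 (h1.trans h12) hC2p hC2 m2)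
    have e : (s2 - s1) ^ 2 * a ^ 2 = ((a * s2 - 2 * π * P) - (a * s1 - 2 * π * P)) ^ 2 := by ring
    rw [e]
    nlinarith [sq_nonneg ((a * s2 - 2 * π * P) + (a * s1 - 2 * π * P))]
  · have hP2' : P ^ 2 ≤ 8 * π ^ 2 := by
      have := pow_le_pow_left₀ hP hP2 2
      have hs : √2 ^ 2 = 2 := Real.sq_sqrt (by norm_num)
      calc P ^ 2 ≤ _ := this
        _ = 4 * √2 ^ 2 * π ^ 2 := by ring
        _ = _ := by rw [hs]; ring
    have hB2 : 4 * π ^ 2 ≤ B ^ 2 := by nlinarith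
    have ha4 : - a ≤ 4 * π ^ 2 := by rw [ha]; linarith
    have hs1 : (s2 - s1) ^ 2 ≤ 1 := by
      rw [sq_le_one_iff_abs_le_one, abs_le]; constructor <;> linarith
    have ha2 : a ^ 2 ≤ 16 * π ^ 4 := by nlinarith [sq_nonneg π]
    have hDp : 4 * π ^ 2 ≤ D := by linarith
    have : (4 * π ^ 2) * (4 * π ^ 2) ≤ D * B ^ 2 := mul_le_mul hDp hB2 (by positivity) (by nlinarith [sq_nonneg π])
    have h5 : (s2 - s1) ^ 2 * a ^ 2 ≤ 1 * a ^ 2 := mul_le_mul_of_nonneg_right hs1 (sq_nonneg _)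
    have h6 : (0:ℝ) ≤ π ^ 4 := by positivity
    have h7 : (4 * π ^ 2) * (4 * π ^ 2) = 16 * π ^ 4 := by ring
    have h8 : D * (4 * B ^ 2) = 4 * (D * B ^ 2) := by ring
    rw [h8]
    linarith

/-- vertical displacement of a point -/
noncomputable def tp (c : ℍ) (r : ℝ) : ℍ := hp (c.re, c.im * exp r)

lemma tp_pos (c : ℍ) (r : ℝ) : 0 < ((c.re, c.im * exp r) : ℝ × ℝ).2 :=
  mul_pos c.im_pos (Real.exp_pos r)

lemma tp_re (c : ℍ) (r : ℝ) : (tp c r).re = c.re := hp_re (tp_pos c r)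
lemma tp_im (c : ℍ) (r : ℝ) : (tp c r).im = c.im * exp r := hp_im (tp_pos c r)

lemma tp_log (c : ℍ) (r : ℝ) : Real.log (tp c r).im = Real.log c.im + r := by
  rw [tp_im, Real.log_mul c.im_pos.ne' (Real.exp_pos r).ne', Real.log_exp]

lemma dist_tp (c : ℍ) (r : ℝ) : dist (tp c r) c = |r| := by
  rw [UpperHalfPlane.dist_of_re_eq (tp_re c r), tp_log, Real.dist_eq]; simp

lemma tp_mem (c : ℍ) (r : ℝ) (hr : 0 ≤ r) : tp c r ∈ closedBall c r ∧ tp c (-r) ∈ closedBall c r := by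
  simp [mem_closedBall, dist_tp, abs_of_nonneg hr]

lemma continuous_tp : Continuous fun q : ℍ × ℝ => tp q.1 q.2 := by
  have h1 := UpperHalfPlane.continuous_re
  have h2 := UpperHalfPlane.continuous_im
  have : Continuous fun q : ℍ × ℝ => ((q.1.re, q.1.im * exp q.2) : ℝ × ℝ) := by fun_prop
  exact continuousOn_hp.comp_continuous this fun q => tp_pos q.1 q.2

lemma le_of_tp (c c' : ℍ) (r R : ℝ) (h1 : tp c r ∈ closedBall c' R) (h2 : tp c (-r) ∈ closedBall c' R) :
    r ≤ R := by
  have g1 := (UpperHalfPlane.dist_log_im_le (tp c r) c').trans h1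
  have g2 := (UpperHalfPlane.dist_log_im_le (tp c (-r)) c').trans h2
  rw [tp_log, Real.dist_eq] at g1 g2
  have := (abs_le.1 g1).2
  have := (abs_le.1 g2).1
  linarith

lemma eq_of_tp (c c' : ℍ) (r : ℝ) (h1 : tp c r ∈ closedBall c' r) (h2 : tp c (-r) ∈ closedBall c' r) :
    c = c' := by
  have g1 := (UpperHalfPlane.dist_log_im_le (tp c r) c').trans h1
  have g2 := (UpperHalfPlane.dist_log_im_le (tp c (-r)) c').trans h2
  rw [tp_log, Real.dist_eq] at g1 g2
  have k1 := (abs_le.1 g1).2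
  have k2 := (abs_le.1 g2).1
  have hlog : Real.log c.im = Real.log c'.im := by linarith
  have him : c.im = c'.im := Real.log_injOn_pos c.im_pos c'.im_pos hlog
  have hr0 : 0 ≤ r := dist_nonneg.trans h1
  have hc : cosh (dist (tp c r) c') ≤ cosh r := by
    apply Real.cosh_le_cosh.2
    rw [abs_of_nonneg dist_nonneg, abs_of_nonneg hr0]; exact h1
  have p := c'.im_pos
  have he := Real.exp_pos r
  rw [cosh_dist_hp', tp_re, tp_im, him, div_le_iff₀ (by positivity), Real.cosh_eq, Real.exp_neg] at hc
  have e : (exp r + (exp r)⁻¹) / 2 * (2 * (c'.im * exp r) * c'.im) = c'.im ^ 2 * exp r ^ 2 + c'.im ^ 2 := by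
    field_simp
  rw [e] at hc
  have h0 : (c.re - c'.re) ^ 2 ≤ 0 := by nlinarith
  have h3 : c.re - c'.re = 0 := pow_eq_zero_iff two_ne_zero |>.1 (le_antisymm h0 (sq_nonneg _))
  rw [← hp_self c, ← hp_self c', him, sub_eq_zero.1 h3]

lemma main_both (K : Set ℍ) (hK : IsCompact K) (hc : HypConvex K) (hi : (interior K).Nonempty)
    (c0 : ℍ) (η : ℝ) (hsub : K ⊆ Metric.closedBall c0 η) (hL : μH[1] (frontier K) ≠ ⊤) :
    0 < hypInradius K ∧ hypInradius K ≤ hypCircumradius K ∧ hypCircumradius K ≤ η ∧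
    ∀ r ∈ Set.Icc (hypInradius K) (hypCircumradius K),
      cosh r * hypArea K + 2 * π * (cosh r - 1) ≤ sinh r * hypPerim K := by
  set I := {r : ℝ | ∃ c : ℍ, Metric.closedBall c r ⊆ K} with hI
  set O := {R : ℝ | ∃ c : ℍ, K ⊆ Metric.closedBall c R} with hO
  have hin : hypInradius K = sSup I := rfl
  have hout : hypCircumradius K = sInf O := rfl
  rw [hin, hout]
  obtain ⟨z0, hz0⟩ := hi
  obtain ⟨ε, hε, hεK⟩ := Metric.nhds_basis_closedBall.mem_iff.1 (mem_interior_iff_mem_nhds.1 hz0)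
  have hεI : ε ∈ I := ⟨z0, hεK⟩
  have hηO : η ∈ O := ⟨c0, hsub⟩
  have hle_all : ∀ r ∈ I, ∀ R ∈ O, 0 ≤ r → r ≤ R := by
    rintro r ⟨c, h1⟩ R ⟨c', h2⟩ hr
    exact le_of_tp c c' r R (h2 (h1 (tp_mem c r hr).1)) (h2 (h1 (tp_mem c r hr).2))
  have hle_all' : ∀ r ∈ I, ∀ R ∈ O, r ≤ R := by
    intro r hr R hR
    rcases le_total 0 r with h | h
    · exact hle_all r hr R hR h
    · exact h.trans (hε.le.trans (hle_all ε hεI R hR hε.le))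
  have hIb : BddAbove I := ⟨η, fun r hr => hle_all' r hr η hηO⟩
  have hOb : BddBelow O := ⟨ε, fun R hR => hle_all' ε hεI R hR⟩
  have hr0 : 0 < sSup I := hε.trans_le (le_csSup hIb hεI)
  have hle : sSup I ≤ sInf O := csSup_le ⟨ε, hεI⟩ fun r hr => le_csInf ⟨η, hηO⟩ fun R hR => hle_all' r hr R hR
  refine ⟨hr0, hle, csInf_le hOb hηO, ?_⟩
  have hmemint : ∀ r ∈ Set.Ioo (sSup I) (sInf O),
      cosh r * hypArea K + 2 * π * (cosh r - 1) ≤ sinh r * hypPerim K := by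
    intro r hr
    refine (main_K K hK hc ⟨z0, hz0⟩ hL r (hr0.trans hr.1) ⟨z0, fun c _ => ⟨fun h => ?_, fun h => ?_⟩⟩).2
    · have := le_csSup hIb (⟨c, h⟩ : r ∈ I)
      have := hr.1; linarith
    · have := csInf_le hOb (⟨c, h⟩ : r ∈ O)
      have := hr.2; linarith
  rcases hle.eq_or_lt with heq | hlt
  · intro r hr
    have hrr : r = sSup I := le_antisymm (by rw [heq]; exact hr.2) hr.1
    -- inner attainment
    obtain ⟨c1, t1, t2⟩ : ∃ c1, tp c1 r ∈ K ∧ tp c1 (-r) ∈ K := by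
      obtain ⟨v, -, hv, hvI⟩ := exists_seq_tendsto_sSup ⟨ε, hεI⟩ hIb
      obtain ⟨N, hN⟩ := Filter.eventually_atTop.1 (hv.eventually_const_lt hr0)
      have hv2 : Filter.Tendsto (fun n => v (n + N)) Filter.atTop (nhds (sSup I)) :=
        (Filter.tendsto_add_atTop_iff_nat N).2 hv
      choose cs hcs using fun n => hvI (n + N)
      have hpos : ∀ n, 0 < v (n + N) := fun n => hN _ (by omega)
      have hcK : ∀ n, cs n ∈ K := fun n => hcs n (mem_closedBall_self (hpos n).le)
      obtain ⟨c, hcc, φ, hφ, hlim⟩ := hK.tendsto_subseq hcK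
      have hv3 := hv2.comp hφ.tendsto_atTop
      rw [← hrr] at hv3
      refine ⟨c, ?_, ?_⟩
      · have := (continuous_tp.tendsto (c, r)).comp (hlim.prodMk_nhds hv3)
        exact hK.isClosed.mem_of_tendsto this (Filter.Eventually.of_forall fun n =>
          hcs _ (tp_mem _ _ (hpos _).le).1)
      · have := (continuous_tp.tendsto (c, -r)).comp (hlim.prodMk_nhds hv3.neg)
        exact hK.isClosed.mem_of_tendsto this (Filter.Eventually.of_forall fun n =>
          hcs _ (tp_mem _ _ (hpos _).le).2)
    -- outer attainment
    obtain ⟨c2, hc2⟩ : ∃ c2, K ⊆ closedBall c2 r := by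
      obtain ⟨v, -, hv, hvO⟩ := exists_seq_tendsto_sInf ⟨η, hηO⟩ hOb
      obtain ⟨N, hN⟩ := Filter.eventually_atTop.1 (hv.eventually_lt_const (lt_add_one (sInf O)))
      have hv2 : Filter.Tendsto (fun n => v (n + N)) Filter.atTop (nhds (sInf O)) :=
        (Filter.tendsto_add_atTop_iff_nat N).2 hv
      choose cs hcs using fun n => hvO (n + N)
      have hlt : ∀ n, v (n + N) < sInf O + 1 := fun n => hN _ (by omega)
      have hmem : ∀ n, cs n ∈ closedBall z0 (sInf O + 1) := fun n => by
        have := hcs n (interior_subset hz0)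
        rw [mem_closedBall, dist_comm] at this
        exact this.trans (hlt n).le
      obtain ⟨c, hcc, φ, hφ, hlim⟩ := (isCompact_closedBall z0 (sInf O + 1)).tendsto_subseq hmem
      have hv3 := hv2.comp hφ.tendsto_atTop
      rw [← heq, ← hrr] at hv3
      refine ⟨c, fun w hw => ?_⟩
      exact le_of_tendsto_of_tendsto' (tendsto_const_nhds.dist hlim) hv3 fun n => hcs _ hw
    have h12 : c1 = c2 := eq_of_tp c1 c2 r (hc2 t1) (hc2 t2)
    have hrp : 0 < r := by rw [hrr]; exact hr0
    refine (main_K K hK hc ⟨z0, hz0⟩ hL r hrp ⟨c1, fun c hne => ⟨fun h => hne ?_, fun h => hne ?_⟩⟩).2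
    · rw [h12]
      exact eq_of_tp c c2 r (hc2 (h (tp_mem c r hrp.le).1)) (hc2 (h (tp_mem c r hrp.le).2))
    · exact (eq_of_tp c1 c r (h t1) (h t2)).symm
  · intro r hr
    rw [← closure_Ioo hlt.ne] at hr
    have hcl : IsClosed {r : ℝ | cosh r * hypArea K + 2 * π * (cosh r - 1) ≤ sinh r * hypPerim K} :=
      isClosed_le (by fun_prop) (by fun_prop)
    exact closure_minimal hmemint hcl hr

/-- Bonnesen-type inequality for the hyperbolic plane `H²`, under the hypothesis that
`K` lies in a closed hyperbolic disc of radius `η = ln(1+√2)` (so `sinh η = 1`). -/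
theorem bonnesen_inequality_hyperbolic_small (K : Set ℍ)
    (hKcomp : IsCompact K) (hKconv : HypConvex K) (hKint : (interior K).Nonempty)
    (h : ∃ c : ℍ, K ⊆ Metric.closedBall c (Real.log (1 + Real.sqrt 2))) :
    hypPerim K ^ 2 - hypArea K * (4 * π + hypArea K) ≥
      (Real.sinh (hypCircumradius K) - Real.sinh (hypInradius K)) ^ 2 *
        ((2 * π + hypArea K) ^ 2 - hypPerim K ^ 2) ^ 2 /
        (4 * (2 * π + hypArea K) ^ 2) := by
  obtain ⟨c, hc⟩ := h
  have hne : K.Nonempty := hKint.mono interior_subset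
  have hb := perim_bound K hKcomp hKconv hne c hc
  have hL : μH[1] (frontier K) ≠ ⊤ := ne_top_of_le_ne_top ENNReal.ofReal_ne_top hb
  obtain ⟨h0, h1, h2, h3⟩ := main_both K hKcomp hKconv hKint c _ hc hL
  have hP : hypPerim K ≤ 2 * √2 * π := by
    unfold hypPerim
    have := ENNReal.toReal_mono ENNReal.ofReal_ne_top hb
    rwa [ENNReal.toReal_ofReal (by positivity)] at this
  have hsinh : sinh (Real.log (1 + √2)) = 1 := by
    rw [Real.sinh_log (by positivity)]
    have hs2 : √2 ^ 2 = 2 := Real.sq_sqrt (by norm_num)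
    field_simp
    nlinarith
  refine final_alg (hypArea K) (hypPerim K) _ _ (cosh (hypInradius K)) (cosh (hypCircumradius K))
    ENNReal.toReal_nonneg ENNReal.toReal_nonneg hP (Real.sinh_nonneg_iff.2 h0.le)
    (Real.sinh_le_sinh.2 h1) ?_ (Real.cosh_sq _) (Real.cosh_sq _) (Real.cosh_pos _).le
    (Real.cosh_pos _).le (h3 _ ⟨le_rfl, h1⟩) (h3 _ ⟨h1, le_rfl⟩)
  rw [← hsinh]
  exact Real.sinh_le_sinh.2 h2
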